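/- arXiv:math/0006232 — 5 statements merged into one kernel-verified Lean document; each statement's English description precedes it below -/
import Mathlib

section
/- Let K be an algebraically closed field of characteristic zero, let n ≥ 1, and let e be an integer with 1 ≤ e < n. Let S ⊆ A be the set consisting of the invariants T_1, …, T_{e−1} together with the n² entries (Φ^e)_{k,l} (1 ≤ k,l ≤ n) of the matrix power Φ^e. Then S is a minimal generating set of the ideal it generates: no element s ∈ S lies in the ideal of A generated by S \ {s}. -/
open MvPolynomial

/-- The generic `n × n` matrix whose `(i,j)` entry is the variable `Φ_{i,j}`. -/
noncomputable def genericMatrix (K : Type*) [CommRing K] (n : ℕ) :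
    Matrix (Fin n) (Fin n) (MvPolynomial (Fin n × Fin n) K) :=
  Matrix.of fun i j => X (i, j)

/-- `T_i`, the sum of all principal `i × i` minors of the generic matrix. -/
noncomputable def principalMinorSum (K : Type*) [CommRing K] (n i : ℕ) :
    MvPolynomial (Fin n × Fin n) K :=
  ∑ I ∈ Finset.univ.powersetCard i,
    Matrix.det ((genericMatrix K n).submatrix
      (fun x : {x : Fin n // x ∈ I} => (x : Fin n)) (fun x : {x : Fin n // x ∈ I} => (x : Fin n)))

namespace MinGen

/-- Sum of principal minors of a matrix over a field. -/
noncomputable def pms {K : Type*} [CommRing K] {n : ℕ} (M : Matrix (Fin n) (Fin n) K) (i : ℕ) : K :=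
  ∑ I ∈ Finset.univ.powersetCard i,
    Matrix.det (M.submatrix
      (fun x : {x : Fin n // x ∈ I} => (x : Fin n)) (fun x : {x : Fin n // x ∈ I} => (x : Fin n)))

/-- The specialisation `Φ ↦ t M`. -/
noncomputable def spec {K : Type*} [CommRing K] {n : ℕ} (M : Matrix (Fin n) (Fin n) K) :
    MvPolynomial (Fin n × Fin n) K →ₐ[K] Polynomial K :=
  MvPolynomial.aeval (fun p => Polynomial.X * Polynomial.C (M p.1 p.2))

lemma spec_generic {K : Type*} [CommRing K] {n : ℕ} (M : Matrix (Fin n) (Fin n) K) :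
    (genericMatrix K n).map (spec M) = (Polynomial.X : Polynomial K) • M.map Polynomial.C := by
  ext1 i j
  simp [genericMatrix, spec]

lemma spec_pow {K : Type*} [CommRing K] {n : ℕ} (M : Matrix (Fin n) (Fin n) K) (e : ℕ)
    (k l : Fin n) : spec M ((genericMatrix K n ^ e) k l) =
      Polynomial.X ^ e * Polynomial.C ((M ^ e) k l) := by
  have h : ((genericMatrix K n) ^ e).map (spec M) =
      (Polynomial.X : Polynomial K) ^ e • (M ^ e).map Polynomial.C := by
    have h1 := map_pow (spec M).mapMatrix (genericMatrix K n) e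
    rw [AlgHom.mapMatrix_apply, AlgHom.mapMatrix_apply, spec_generic, smul_pow] at h1
    rw [h1, Matrix.map_pow]
  have := congrFun (congrFun h k) l
  simpa using this

lemma spec_pms {K : Type*} [CommRing K] {n : ℕ} (M : Matrix (Fin n) (Fin n) K) (i : ℕ) :
    spec M (principalMinorSum K n i) = Polynomial.X ^ i * Polynomial.C (pms M i) := by
  unfold principalMinorSum pms
  rw [map_sum, map_sum, Finset.mul_sum]
  refine Finset.sum_congr rfl fun I hI => ?_
  rw [AlgHom.map_det, RingHom.map_det, AlgHom.mapMatrix_apply, RingHom.mapMatrix_apply,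
    ← Matrix.submatrix_map, spec_generic]
  rw [Finset.mem_powersetCard] at hI
  have h2 : Fintype.card {x : Fin n // x ∈ I} = i := by simp [hI.2]
  rw [← h2, ← Matrix.det_smul]
  rfl

/-- truncated permutation matrix -/
def cyc (K : Type*) [CommRing K] {n : ℕ} (I : Finset (Fin n)) (σ : Equiv.Perm (Fin n)) :
    Matrix (Fin n) (Fin n) K :=
  Matrix.of fun i j => if i ∈ I ∧ j = σ i then 1 else 0

/-- modified cyclic matrix -/
def mcyc (K : Type*) [CommRing K] {n : ℕ} (I : Finset (Fin n)) (σ : Equiv.Perm (Fin n))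
    (k l : Fin n) (x : K) : Matrix (Fin n) (Fin n) K :=
  cyc K I σ * (1 - Matrix.single k l x)

section
variable {K : Type*} [Field K] {n : ℕ} {I : Finset (Fin n)} {σ : Equiv.Perm (Fin n)}

lemma cyc_pow (hσ : σ.IsCycleOn (I : Set (Fin n))) (m : ℕ) : cyc K I σ ^ (m + 1) =
    Matrix.of fun i j => if i ∈ I ∧ j = (σ ^ (m + 1)) i then 1 else 0 := by
  induction m with
  | zero => simp [cyc]
  | succ m ih =>
    rw [pow_succ', ih]
    ext i j
    rw [Matrix.mul_apply]
    by_cases hi : i ∈ I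
    · have h2 : σ i ∈ I := by
        have := hσ.1.mapsTo (x := i) (by simpa using hi)
        simpa using this
      rw [Finset.sum_eq_single (σ i)]
      · simp [cyc, hi, h2, pow_succ (σ) (m + 1)]
      · intro b _ hb
        simp [cyc, hb]
      · simp
    · simp [cyc, hi]

lemma cyc_pow_card (hσ : σ.IsCycleOn (I : Set (Fin n))) (hI : 1 ≤ I.card) : cyc K I σ ^ I.card =
    Matrix.diagonal fun i => if i ∈ I then 1 else 0 := by
  obtain ⟨m, hm⟩ : ∃ m, I.card = m + 1 := ⟨I.card - 1, by omega⟩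
  rw [hm, cyc_pow hσ, ← hm]
  ext i j
  by_cases hi : i ∈ I
  · have := hσ.pow_card_apply hi
    simp [hi, this, Matrix.diagonal_apply, eq_comm]
  · simp [hi, Matrix.diagonal_apply]

lemma mcyc_pow {k l : Fin n} (hl : l ∉ I) (x : K) (m : ℕ) :
    mcyc K I σ k l x ^ (m + 1) = cyc K I σ ^ (m + 1) * (1 - Matrix.single k l x) := by
  have hz : Matrix.single k l x * cyc K I σ = 0 := by
    ext i j
    rw [Matrix.mul_apply]
    refine Finset.sum_eq_zero fun b _ => ?_
    by_cases hb : l = b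
    · subst hb; simp [cyc, hl]
    · simp [Matrix.single, hb]
  induction m with
  | zero => simp [mcyc]
  | succ m ih =>
    rw [pow_succ', ih, mcyc, mul_assoc, ← mul_assoc (1 - _), pow_succ', ← mul_assoc (1 - _),
      sub_mul, hz]
    simp [mul_assoc, pow_succ']

lemma mcyc_apply {k l : Fin n} (x : K) (i j : Fin n) (hj : j ≠ l) :
    mcyc K I σ k l x i j = cyc K I σ i j := by
  have : (cyc K I σ * Matrix.single k l x) i j = 0 := by
    rw [Matrix.mul_apply]
    refine Finset.sum_eq_zero fun b _ => ?_
    simp [Matrix.single, hj.symm]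
  rw [mcyc, mul_sub, Matrix.sub_apply, this]
  simp

lemma mcyc_row {k l : Fin n} (x : K) (i j : Fin n) (hi : i ∉ I) :
    mcyc K I σ k l x i j = 0 := by
  rw [mcyc, Matrix.mul_apply]
  refine Finset.sum_eq_zero fun b _ => ?_
  simp [cyc, hi]

lemma minor_zero (hσ : σ.IsCycleOn (I : Set (Fin n))) {k l : Fin n} (hl : l ∉ I) (x : K) (J : Finset (Fin n)) (hJ : J.Nonempty)
    (hJI : J ≠ I) : Matrix.det ((mcyc K I σ k l x).submatrix
      (fun x : {x : Fin n // x ∈ J} => (x : Fin n))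
      (fun x : {x : Fin n // x ∈ J} => (x : Fin n))) = 0 := by
  by_cases hsub : J ⊆ I
  · have : ∃ a ∈ J, σ a ∉ J := by
      by_contra! hcon
      apply hJI
      refine Finset.Subset.antisymm hsub fun b hb => ?_
      obtain ⟨a, ha⟩ := hJ
      obtain ⟨m, -, hm⟩ := hσ.exists_pow_eq (hsub ha) hb
      have : ∀ m : ℕ, (σ ^ m) a ∈ J := by
        intro m
        induction m with
        | zero => simpa using ha
        | succ m ih => rw [pow_succ']; exact hcon _ ih
      rw [← hm]; exact this m
    obtain ⟨a, ha, ha2⟩ := this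
    refine Matrix.det_eq_zero_of_row_eq_zero ⟨a, ha⟩ fun j => ?_
    have hj : (j : Fin n) ≠ l := fun h => hl (h ▸ hsub j.2)
    simp only [Matrix.submatrix_apply]
    rw [mcyc_apply _ _ _ hj]
    have : (j : Fin n) ≠ σ a := fun h => ha2 (h ▸ j.2)
    simp [cyc, this]
  · obtain ⟨a, ha, ha2⟩ := Finset.not_subset.1 hsub
    exact Matrix.det_eq_zero_of_row_eq_zero ⟨a, ha⟩ fun j => mcyc_row _ _ _ ha2

lemma pms_zero (hσ : σ.IsCycleOn (I : Set (Fin n))) {k l : Fin n} (hl : l ∉ I) (x : K) (j : ℕ) (hj : 1 ≤ j) (hjI : j ≠ I.card) :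
    pms (mcyc K I σ k l x) j = 0 := by
  refine Finset.sum_eq_zero fun J hJ => ?_
  rw [Finset.mem_powersetCard] at hJ
  refine minor_zero hσ hl x J (Finset.card_pos.1 (by omega)) ?_
  rintro rfl
  omega

lemma pms_ne_zero (hσ : σ.IsCycleOn (I : Set (Fin n))) {k l : Fin n} (hl : l ∉ I) (x : K) (hI : 1 ≤ I.card) :
    pms (mcyc K I σ k l x) I.card ≠ 0 := by
  unfold pms
  rw [Finset.sum_eq_single I]
  · have hmem : ∀ y, σ y ∈ I ↔ y ∈ I := fun y => by
      simpa using hσ.apply_mem_iff (x := y)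
    have : ((mcyc K I σ k l x).submatrix
      (fun x : {x : Fin n // x ∈ I} => (x : Fin n))
      (fun x : {x : Fin n // x ∈ I} => (x : Fin n))) =
        (σ.subtypePerm (p := fun y => y ∈ I) hmem).permMatrix K := by
      ext i j
      have hj : (j : Fin n) ≠ l := fun h => hl (h ▸ j.2)
      simp only [Matrix.submatrix_apply]
      rw [mcyc_apply _ _ _ hj]
      simp [cyc, Equiv.Perm.permMatrix, PEquiv.toMatrix_apply, Subtype.ext_iff, eq_comm]
    rw [this, Matrix.det_permutation]
    have h1 := Int.isUnit_iff.1 (Equiv.Perm.sign (σ.subtypePerm (p := fun y => y ∈ I) hmem)).isUnit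
    rcases h1 with h | h <;> simp [h]
  · intro J hJ hne
    rw [Finset.mem_powersetCard] at hJ
    exact minor_zero hσ hl x J (Finset.card_pos.1 (by omega)) hne
  · simp

end

lemma caseT {K : Type*} [Field K] (n e i : ℕ) (hen : e < n) (hi : 1 ≤ i) (hie : i ≤ e - 1)
    (U : Set (MvPolynomial (Fin n × Fin n) K))
    (hU : ∀ f ∈ U, (∃ j, 1 ≤ j ∧ j ≠ i ∧ f = principalMinorSum K n j) ∨
      ∃ k l, f = (genericMatrix K n ^ e) k l) :
    principalMinorSum K n i ∉ Ideal.span U := by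
  intro hmem
  obtain ⟨I, -, hI⟩ := Finset.exists_subset_card_eq (s := (Finset.univ : Finset (Fin n))) (n := i)
    (by simp; omega)
  obtain ⟨l, hl⟩ : ∃ l, l ∉ I := by
    by_contra! h
    have : I = Finset.univ := Finset.eq_univ_iff_forall.2 h
    rw [this] at hI
    simp at hI
    omega
  obtain ⟨σ, hσ, -⟩ := I.exists_cycleOn
  set M := mcyc K I σ l l 0
  have hle : Ideal.span U ≤ (Ideal.span {(Polynomial.X : Polynomial K) ^ e}).comap (spec M) := by
    rw [Ideal.span_le]
    intro f hf
    simp only [SetLike.mem_coe, Ideal.mem_comap, Ideal.mem_span_singleton]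
    rcases hU f hf with ⟨j, hj, hji, rfl⟩ | ⟨k, l, rfl⟩
    · rw [spec_pms, pms_zero hσ hl 0 j hj (by omega)]
      simp
    · rw [spec_pow]
      exact dvd_mul_right _ _
  have h := hle hmem
  rw [Ideal.mem_comap, Ideal.mem_span_singleton, spec_pms, Polynomial.X_pow_dvd_iff] at h
  have h2 := h i (by omega)
  have h3 := pms_ne_zero hσ (K := K) (k := l) hl 0 (by omega)
  rw [hI] at h3
  apply h3
  simpa using h2

lemma entry_functional {K : Type*} [Field K] (n e : ℕ) (k l : Fin n)
    (U : Set (MvPolynomial (Fin n × Fin n) K))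
    (hU : ∀ f ∈ U, (∃ j, 1 ≤ j ∧ j ≤ e - 1 ∧ f = principalMinorSum K n j) ∨
      ∃ p q, (p, q) ≠ (k, l) ∧ f = (genericMatrix K n ^ e) p q)
    (f : MvPolynomial (Fin n × Fin n) K) (hf : f ∈ Ideal.span U) :
    ∃ c : Fin n × Fin n → K, c (k, l) = 0 ∧ ∀ M : Matrix (Fin n) (Fin n) K,
      (∀ j, 1 ≤ j → j ≤ e - 1 → pms M j = 0) →
      Polynomial.X ^ e ∣ spec M f ∧ (spec M f).coeff e = ∑ p, c p * (M ^ e) p.1 p.2 := by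
  refine Submodule.span_induction ?_ ?_ ?_ ?_ hf
  · intro f hf
    rcases hU f hf with ⟨j, hj, hji, rfl⟩ | ⟨p, q, hpq, rfl⟩
    · refine ⟨0, rfl, fun M hM => ?_⟩
      rw [spec_pms, hM j hj hji]
      simp
    · refine ⟨Pi.single (p, q) 1, Pi.single_eq_of_ne hpq.symm _, fun M hM => ?_⟩
      rw [spec_pow]
      refine ⟨dvd_mul_right _ _, ?_⟩
      rw [Finset.sum_eq_single (p, q)]
      · simp
      · intro b _ hb
        simp [hb]
      · simp
  · exact ⟨0, rfl, fun M hM => by simp⟩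
  · rintro f g - - ⟨c, hc, h1⟩ ⟨d, hd, h2⟩
    refine ⟨c + d, by simp [hc, hd], fun M hM => ?_⟩
    obtain ⟨a1, a2⟩ := h1 M hM
    obtain ⟨b1, b2⟩ := h2 M hM
    rw [map_add]
    refine ⟨dvd_add a1 b1, ?_⟩
    simp [a2, b2, add_mul, Finset.sum_add_distrib]
  · rintro a f - ⟨c, hc, h1⟩
    refine ⟨MvPolynomial.constantCoeff a • c, by simp [hc], fun M hM => ?_⟩
    obtain ⟨a1, a2⟩ := h1 M hM
    have h0 : (spec M a).coeff 0 = MvPolynomial.constantCoeff a := by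
      have : (Polynomial.constantCoeff.comp (spec M).toRingHom) =
          (MvPolynomial.constantCoeff : MvPolynomial (Fin n × Fin n) K →+* K) := by
        apply MvPolynomial.ringHom_ext
        · intro r; simp [spec]
        · intro p; simp [spec]
      exact congrArg (fun g => g a) this
    rw [smul_eq_mul, map_mul]
    refine ⟨dvd_mul_of_dvd_right a1 _, ?_⟩
    obtain ⟨g, hg⟩ := a1
    rw [hg] at a2 ⊢
    have e1 : spec M a * (Polynomial.X ^ e * g) = Polynomial.X ^ e * (spec M a * g) := by ring
    have e2 := Polynomial.coeff_X_pow_mul g e 0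
    have e3 := Polynomial.coeff_X_pow_mul (spec M a * g) e 0
    rw [zero_add] at e2 e3
    rw [e1, e3, Polynomial.mul_coeff_zero, ← e2, a2, h0, Finset.mul_sum]
    simp [mul_assoc]

lemma functional_zero {K : Type*} [Field K] [CharZero K] (n e : ℕ) (he : 1 ≤ e) (hen : e < n)
    (c : Fin n × Fin n → K)
    (hc : ∀ M : Matrix (Fin n) (Fin n) K, (∀ j, 1 ≤ j → j ≤ e - 1 → pms M j = 0) →
      ∑ p, c p * (M ^ e) p.1 p.2 = 0) (k l : Fin n) : c (k, l) = 0 := by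
  have key : ∀ I : Finset (Fin n), I.card = e → ∀ k ∈ I, ∀ l ∉ I, ∀ x : K,
      ∑ i ∈ I, c (i, i) - x * c (k, l) = 0 := by
    intro I hI k hk l hl x
    obtain ⟨σ, hσ, -⟩ := I.exists_cycleOn
    have h := hc (mcyc K I σ k l x) fun j hj hje => pms_zero hσ hl x j hj (by omega)
    have hp : mcyc K I σ k l x ^ e = (Matrix.diagonal fun i => if i ∈ I then 1 else 0) -
        Matrix.single k l x := by
      obtain ⟨m, rfl⟩ : ∃ m, e = m + 1 := ⟨e - 1, by omega⟩
      rw [mcyc_pow hl, ← hI, cyc_pow_card hσ (by omega), mul_sub, mul_one]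
      congr 1
      ext i j
      rw [Matrix.diagonal_mul]
      by_cases hi : k = i
      · subst hi; simp [hk]
      · simp [Matrix.single, hi]
    rw [hp] at h
    rw [← h]
    simp only [Matrix.sub_apply, mul_sub, Finset.sum_sub_distrib]
    congr 1
    · rw [Fintype.sum_prod_type]
      simp [Matrix.diagonal_apply, Finset.sum_ite_mem]
    · rw [Finset.sum_eq_single (k, l)]
      · simp [mul_comm]
      · rintro ⟨p, q⟩ _ hb
        have : ¬ (k = p ∧ l = q) := fun h => hb (by rw [h.1, h.2])
        simp [Matrix.single, this]
      · simp
  have exI : ∀ k l : Fin n, k ≠ l → ∃ I : Finset (Fin n), I.card = e ∧ k ∈ I ∧ l ∉ I := by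
    intro k l hkl
    obtain ⟨I, h1, h2, h3⟩ := Finset.exists_subsuperset_card_eq (s := {k})
      (t := Finset.univ.erase l) (n := e) (by simp [hkl]) (by simpa using he)
      (by simp; omega)
    exact ⟨I, h3, h1 (by simp), fun h => by simpa using h2 h⟩
  by_cases hkl : k = l
  · subst hkl
    have hall : ∀ m, c (m, m) = c (k, k) := by
      intro m
      by_cases hm : k = m
      · rw [hm]
      obtain ⟨I, h1, h2, h3⟩ := exI k m hm
      have s1 := key I h1 k h2 m h3 0
      have h4 : m ∉ I.erase k := fun h => h3 (Finset.mem_of_mem_erase h)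
      have s2 := key (insert m (I.erase k))
        (by rw [Finset.card_insert_of_notMem h4, Finset.card_erase_of_mem h2]; omega)
        m (by simp) k (by simp [hm]) 0
      rw [Finset.sum_insert h4] at s2
      have s3 := Finset.add_sum_erase I (fun i => c (i, i)) h2
      linear_combination s2 - s1 - s3
    obtain ⟨m, hm⟩ : ∃ m, k ≠ m := by
      have : Nontrivial (Fin n) := Fin.nontrivial_iff_two_le.2 (by omega)
      obtain ⟨m, hm⟩ := exists_ne k
      exact ⟨m, hm.symm⟩
    obtain ⟨I, h1, h2, h3⟩ := exI k m hm
    have s1 := key I h1 k h2 m h3 0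
    rw [Finset.sum_congr rfl fun i _ => hall i] at s1
    simp [h1] at s1
    rcases s1 with h | h
    · omega
    · exact h
  · obtain ⟨I, h1, h2, h3⟩ := exI k l hkl
    have s1 := key I h1 k h2 l h3 0
    have s2 := key I h1 k h2 l h3 1
    linear_combination s1 - s2

lemma caseE {K : Type*} [Field K] [CharZero K] (n e : ℕ) (he : 1 ≤ e) (hen : e < n) (k l : Fin n)
    (U : Set (MvPolynomial (Fin n × Fin n) K))
    (hU : ∀ f ∈ U, (∃ j, 1 ≤ j ∧ j ≤ e - 1 ∧ f = principalMinorSum K n j) ∨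
      ∃ p q, (p, q) ≠ (k, l) ∧ f = (genericMatrix K n ^ e) p q) :
    (genericMatrix K n ^ e) k l ∉ Ideal.span U := by
  intro hmem
  obtain ⟨c, hc, h⟩ := entry_functional n e k l U hU _ hmem
  have := functional_zero n e he hen (c - Pi.single (k, l) 1) (fun M hM => by
    have h2 := (h M hM).2
    rw [spec_pow] at h2
    simp only [Pi.sub_apply, sub_mul, Finset.sum_sub_distrib]
    rw [← h2, Finset.sum_eq_single (k, l) (fun b _ hb => by simp [hb]) (by simp)]
    simp) k l
  simp [hc] at this

end MinGen

theorem minimal_generators_of_e_nilpotent_ideal (K : Type*) [Field K] [IsAlgClosed K]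
    [CharZero K] (n e : ℕ) (hn : 1 ≤ n) (he : 1 ≤ e) (hen : e < n)
    (S : Set (MvPolynomial (Fin n × Fin n) K))
    (hS : S = {f | ∃ i, 1 ≤ i ∧ i ≤ e - 1 ∧ f = principalMinorSum K n i} ∪
              {f | ∃ k l, f = (genericMatrix K n ^ e) k l}) :
    ∀ s ∈ S, s ∉ Ideal.span (S \ {s}) := by
  intro s hs
  subst hS
  rcases hs with ⟨i, hi, hie, rfl⟩ | ⟨k, l, rfl⟩
  · refine MinGen.caseT n e i hen hi hie _ ?_
    rintro f ⟨⟨j, hj, hje, rfl⟩ | h, hne⟩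
    · exact Or.inl ⟨j, hj, fun h => hne (by rw [h]; rfl), rfl⟩
    · exact Or.inr h
  · refine MinGen.caseE n e he hen k l _ ?_
    rintro f ⟨h | ⟨p, q, rfl⟩, hne⟩
    · exact Or.inl h
    · refine Or.inr ⟨p, q, fun h => hne ?_, rfl⟩
      obtain ⟨rfl, rfl⟩ := Prod.mk.inj h
      rfl
end

section
/- Let K be an algebraically closed field (of arbitrary characteristic) and let n ≥ 1. Then the ideal of all polynomials in A = K[Φ_{i,j} : 1 ≤ i,j ≤ n] vanishing at every matrix M ∈ Mat_n(K) with M² = 0 is equal to the ideal of A generated by the invariants T_1, T_2, …, T_n together with the n² entries of the matrix Φ². -/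
open MvPolynomial

section Rel
variable {R : Type*} [CommRing R] {n : ℕ}

/-- Multilinear expansion of a determinant with perturbed rows. -/
lemma sq_det_expand (v w : Fin n → Fin n → R) (e : Fin n → R) :
    Matrix.det (Matrix.of fun j => v j + e j • w j) =
      ∑ s : Finset (Fin n), (∏ j ∈ s, e j) *
        Matrix.det (Matrix.of fun j => if j ∈ s then w j else v j) := by
  have h := (Matrix.detRowAlternating (R := R) (n := Fin n)).map_add_univ (fun j => e j • w j) v
  have e1 : Matrix.det (Matrix.of fun j => v j + e j • w j) =
      (Matrix.detRowAlternating (R := R) (n := Fin n)) ((fun j => e j • w j) + v) := by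
    change Matrix.det _ = Matrix.det _
    congr 1
    funext j
    exact add_comm _ _
  rw [e1, h]
  refine Finset.sum_congr rfl fun s _ => ?_
  have h2 := (Matrix.detRowAlternating (R := R) (n := Fin n)).toMultilinearMap.map_piecewise_smul
    e (s.piecewise w v) s
  have e2 : (s.piecewise (fun j => e j • w j) v) =
      s.piecewise (fun i => e i • (s.piecewise w v) i) (s.piecewise w v) := by
    funext j
    by_cases hj : j ∈ s <;> simp [hj]
  rw [e2]
  refine h2.trans ?_
  rw [smul_eq_mul]
  congr 1

lemma sq_det_mulVec (B : Matrix (Fin n) (Fin n) R) (v : Fin n → Fin n → R) :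
    Matrix.det (Matrix.of fun j => B.mulVec (v j)) = B.det * Matrix.det (Matrix.of v) := by
  have : (Matrix.of fun j => B.mulVec (v j)) = Matrix.of v * B.transpose := by
    ext i j
    simp [Matrix.mul_apply, Matrix.mulVec, dotProduct, mul_comm]
  rw [this, Matrix.det_mul, Matrix.det_transpose, mul_comm]

lemma sq_swap_rel (Φ : Matrix (Fin n) (Fin n) R) (h2 : Φ * Φ = 0)
    (hd : Matrix.det (1 + (Polynomial.X : Polynomial R) • Φ.map Polynomial.C) = 1)
    (v : Fin n → Fin n → R) (D : Finset (Fin n)) :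
    ∑ P : Finset (Fin n), (if Disjoint P D ∧ P.card = D.card then
        Matrix.det (Matrix.of fun j => if j ∈ P then Φ.mulVec (v j) else v j) else 0) =
      (-1) ^ D.card * Matrix.det (Matrix.of fun j => if j ∈ D then Φ.mulVec (v j) else v j) := by
  set Ψ := Φ.map Polynomial.C with hΨ
  have hΨ2 : Ψ * Ψ = 0 := by
    rw [hΨ, ← Matrix.map_mul, h2]; simp
  set B := 1 - (Polynomial.X : Polynomial R) • Ψ with hB
  have hBm : B * (1 + (Polynomial.X : Polynomial R) • Ψ) = 1 := by
    simp [hB, sub_mul, mul_add, hΨ2]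
  have hBd : B.det = 1 := by
    have := congrArg Matrix.det hBm
    rwa [Matrix.det_mul, hd, mul_one, Matrix.det_one] at this
  let V : Fin n → Fin n → Polynomial R := fun j i => Polynomial.C (v j i)
  have hV : ∀ j, Ψ.mulVec (V j) = fun i => Polynomial.C (Φ.mulVec (v j) i) := by
    intro j; funext i
    simp [Matrix.mulVec, dotProduct, hΨ, V]
  have hΨΨ : ∀ u, Ψ.mulVec (Ψ.mulVec u) = 0 := by
    intro u; rw [Matrix.mulVec_mulVec, hΨ2, Matrix.zero_mulVec]
  have key := sq_det_mulVec B (fun j => V j + (if j ∈ D then 0 else Polynomial.X : Polynomial R) • Ψ.mulVec (V j))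
  have e1 : (fun j => B.mulVec (V j + (if j ∈ D then 0 else Polynomial.X : Polynomial R) • Ψ.mulVec (V j))) =
      fun j => V j + (if j ∈ D then -Polynomial.X else 0 : Polynomial R) • Ψ.mulVec (V j) := by
    funext j
    by_cases hj : j ∈ D
    · simp [hj, hB, Matrix.sub_mulVec, Matrix.smul_mulVec]
      exact sub_eq_add_neg _ _
    · simp only [hj, if_false, hB, Matrix.sub_mulVec, Matrix.smul_mulVec, Matrix.mulVec_add,
        Matrix.mulVec_smul, Matrix.one_mulVec, hΨΨ, smul_zero]
      simp
  rw [e1, hBd, one_mul, sq_det_expand, sq_det_expand] at key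
  have hC : ∀ s : Finset (Fin n),
      Matrix.det (Matrix.of fun j => if j ∈ s then Ψ.mulVec (V j) else V j) =
      Polynomial.C (Matrix.det (Matrix.of fun j => if j ∈ s then Φ.mulVec (v j) else v j)) := by
    intro s
    rw [RingHom.map_det]
    congr 1
    ext1 i j
    by_cases hi : i ∈ s <;> simp [hi, hV, V]
  simp only [hC] at key
  have p1 : ∀ s : Finset (Fin n), ∏ j ∈ s, (if j ∈ D then -Polynomial.X else 0 : Polynomial R) =
      if s ⊆ D then Polynomial.C ((-1) ^ s.card) * Polynomial.X ^ s.card else 0 := by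
    intro s
    split_ifs with h
    · rw [Finset.prod_congr rfl (fun j hj => if_pos (h hj)), Finset.prod_const, neg_pow]
      simp
    · obtain ⟨j, hj, hj'⟩ := Finset.not_subset.mp h
      exact Finset.prod_eq_zero hj (if_neg hj')
  have p2 : ∀ s : Finset (Fin n), ∏ j ∈ s, (if j ∈ D then 0 else Polynomial.X : Polynomial R) =
      if Disjoint s D then Polynomial.X ^ s.card else 0 := by
    intro s
    split_ifs with h
    · rw [Finset.prod_congr rfl (fun j hj => if_neg (Finset.disjoint_left.mp h hj)),
        Finset.prod_const]
    · obtain ⟨j, hj, hj'⟩ := Finset.not_disjoint_iff.mp h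
      exact Finset.prod_eq_zero hj (if_pos hj')
  simp only [p1, p2] at key
  have k2 := congrArg (fun p => Polynomial.coeff p D.card) key
  simp only [Polynomial.finsetSum_coeff, Polynomial.coeff_mul_C, apply_ite (fun p : Polynomial R =>
    Polynomial.coeff p D.card), Polynomial.coeff_C_mul, Polynomial.coeff_X_pow,
    Polynomial.coeff_zero] at k2
  rw [Finset.sum_eq_single D] at k2
  · simp only [subset_refl, if_true, mul_one] at k2
    rw [k2]
    refine Finset.sum_congr rfl fun P _ => ?_
    by_cases h : Disjoint P D <;> by_cases h' : P.card = D.card <;> simp [h, h']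
    exact fun h => absurd h.symm h'
  · intro s _ hs
    by_cases h : s ⊆ D
    · have : ¬ D.card = s.card := fun hc => hs (Finset.eq_of_subset_of_card_le h hc.le)
      simp [this]
    · simp [h]
  · simp
end Rel

section Viol
variable {R : Type*} [CommRing R] {n : ℕ}

/-- Columns of the `n × 2n` matrix `[Φ | J]`, `J` the antidiagonal permutation matrix. -/
def sqY (Φ : Matrix (Fin n) (Fin n) R) (x : Fin (2 * n)) : Fin n → R :=
  if h : x.val < n then (fun i => Φ i ⟨x.val, h⟩)
  else Pi.single (⟨2 * n - 1 - x.val, by omega⟩ : Fin n) 1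

/-- Maximal minors of `[Φ | J]`. -/
def sqD (Φ : Matrix (Fin n) (Fin n) R) (c : Fin n → Fin (2 * n)) : R :=
  Matrix.det (Matrix.of fun j => sqY Φ (c j))

/-- A weight on column indices. -/
def sqMu (x : Fin (2 * n)) : ℕ :=
  if x.val < n then 2 ^ n - 2 ^ x.val else 2 ^ n + 2 ^ (2 * n - 1 - x.val)

lemma sqMu_rev (x : Fin (2 * n)) (h : x.val < n) :
    sqMu x.rev = sqMu x + 2 * 2 ^ x.val := by
  have h1 : ¬ (x.rev.val < n) := by rw [Fin.val_rev]; omega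
  have h2 : 2 * n - 1 - x.rev.val = x.val := by rw [Fin.val_rev]; omega
  have h3 : 2 ^ x.val ≤ 2 ^ n := Nat.pow_le_pow_right (by norm_num) h.le
  simp only [sqMu, h, h1, h2, if_true, if_false]
  omega

lemma sqY_high (Φ : Matrix (Fin n) (Fin n) R) (x : Fin (2 * n)) (h : ¬ x.val < n) :
    Φ.mulVec (sqY Φ x) = sqY Φ x.rev := by
  have h1 : x.rev.val < n := by rw [Fin.val_rev]; omega
  simp only [sqY, h, h1, dif_pos, dif_neg, not_false_eq_true]
  rw [Matrix.mulVec_single_one]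
  funext i
  simp only [Matrix.col_apply]
  congr 1
  apply Fin.ext
  simp [Fin.val_rev]
  omega

lemma sqY_low (Φ : Matrix (Fin n) (Fin n) R) (h2 : Φ * Φ = 0) (x : Fin (2 * n))
    (h : x.val < n) : Φ.mulVec (sqY Φ x) = 0 := by
  simp only [sqY, h, dif_pos]
  funext i
  have := congrFun (congrFun h2 i) ⟨x.val, h⟩
  simpa [Matrix.mul_apply, Matrix.mulVec, dotProduct] using this

lemma sqD_eq_zero (Φ : Matrix (Fin n) (Fin n) R) (c : Fin n → Fin (2 * n))
    (h : ¬ Function.Injective c) : sqD Φ c = 0 := by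
  simp only [Function.Injective, not_forall] at h
  obtain ⟨a, b, hab, hne⟩ := h
  apply Matrix.det_zero_of_row_eq hne
  funext i
  simp [hab]

lemma sq_card_lt (c : Fin n → Fin (2 * n)) (hc : StrictMono c) (j : Fin n)
    (hj : (c j).val + (c j.rev).val < 2 * n - 1) :
    (Finset.univ.filter fun k => (c k).rev ≤ c j ∧ ∀ l, c l ≠ (c k).rev).card <
    (Finset.univ.filter fun k => c k ≤ c j ∧ ∀ l, c l ≠ (c k).rev).card := by
  set Lo := Finset.univ.filter fun k => c k ≤ c j with hLo
  set Hi := Finset.univ.filter fun k => (c k).rev ≤ c j with hHi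
  have e1 : (Finset.univ.filter fun k => (c k).rev ≤ c j ∧ ∀ l, c l ≠ (c k).rev) =
    Hi.filter fun k => ∀ l, c l ≠ (c k).rev := by rw [hHi, Finset.filter_filter]
  have e2 : (Finset.univ.filter fun k => c k ≤ c j ∧ ∀ l, c l ≠ (c k).rev) =
    Lo.filter fun k => ∀ l, c l ≠ (c k).rev := by rw [hLo, Finset.filter_filter]
  rw [e1, e2]
  have c1 := Finset.card_filter_add_card_filter_not (s := Hi) (fun k => ∀ l, c l ≠ (c k).rev)
  have c2 := Finset.card_filter_add_card_filter_not (s := Lo) (fun k => ∀ l, c l ≠ (c k).rev)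
  have c3 : Lo.card = j.val + 1 := by
    have : Lo = Finset.Iic j := by
      ext k; simp [hLo, hc.le_iff_le]
    rw [this, Fin.card_Iic]
  have c4 : Hi.card ≤ j.val := by
    have : Hi ⊆ Finset.Ioi j.rev := by
      intro k hk
      simp only [hHi, Finset.mem_filter, Finset.mem_univ, true_and, Fin.le_def, Fin.val_rev] at hk
      rw [Finset.mem_Ioi, ← hc.lt_iff_lt, Fin.lt_def]
      omega
    have h := Finset.card_le_card this
    rw [Fin.card_Ioi, Fin.val_rev] at h
    omega
  have c5 : (Lo.filter fun k => ¬ ∀ l, c l ≠ (c k).rev).card ≤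
      (Hi.filter fun k => ¬ ∀ l, c l ≠ (c k).rev).card := by
    have hex : ∀ k, ∃ l, k ∈ (Lo.filter fun k => ¬ ∀ l, c l ≠ (c k).rev) → c l = (c k).rev := by
      intro k
      by_cases hk : k ∈ (Lo.filter fun k => ¬ ∀ l, c l ≠ (c k).rev)
      · have := (Finset.mem_filter.mp hk).2
        push Not at this
        obtain ⟨l, hl⟩ := this
        exact ⟨l, fun _ => hl⟩
      · exact ⟨k, fun h => absurd h hk⟩
    choose g hg using hex
    apply Finset.card_le_card_of_injOn g
    · intro k hk
      have hgk := hg k hk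
      have hk' := Finset.mem_filter.mp hk
      simp only [hLo, Finset.mem_filter, Finset.mem_univ, true_and] at hk'
      simp only [hHi, Finset.coe_filter, Finset.mem_filter, Finset.mem_univ, true_and,
        Set.mem_ofPred_eq, hgk, Fin.rev_rev]
      refine ⟨hk'.1, ?_⟩
      push Not
      exact ⟨k, rfl⟩
    · intro k hk k' hk' h
      have h1 := hg k hk
      have h2 := hg k' hk'
      rw [h] at h1
      exact hc.injective (Fin.rev_injective (h1.symm.trans h2))
  omega

lemma sqD_viol (K : Type*) [CommRing K] [Algebra K R]
    (Φ : Matrix (Fin n) (Fin n) R) (h2 : Φ * Φ = 0)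
    (hd : Matrix.det (1 + (Polynomial.X : Polynomial R) • Φ.map Polynomial.C) = 1)
    (c : Fin n → Fin (2 * n)) (hc : StrictMono c) (j : Fin n)
    (hj : (c j).val + (c j.rev).val < 2 * n - 1) :
    sqD Φ c ∈ Submodule.span K (sqD Φ '' {c' | ∑ k, sqMu (c' k) < ∑ k, sqMu (c k)}) := by
  wlog hle : (c j).val ≤ (c j.rev).val generalizing j
  · exact this j.rev (by rw [Fin.rev_rev]; omega) (by rw [Fin.rev_rev]; omega)
  set D := (Finset.univ.filter fun k => c k ≤ c j ∧ ∀ l, c l ≠ (c k).rev) with hD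
  have hjn : (c j).val < n := by omega
  have hDlow : ∀ k ∈ D, (c k).val < n := by
    intro k hk
    have := (Finset.mem_filter.mp hk).2.1
    rw [Fin.le_def] at this
    omega
  have hrel := sq_swap_rel Φ h2 hd (fun k => sqY Φ (if k ∈ D then (c k).rev else c k)) D
  have e1 : Matrix.det (Matrix.of fun k => if k ∈ D then
      Φ.mulVec (sqY Φ (if k ∈ D then (c k).rev else c k)) else
      sqY Φ (if k ∈ D then (c k).rev else c k)) = sqD Φ c := by
    refine congrArg (fun f => Matrix.det (Matrix.of f)) (funext fun k => ?_)
    by_cases hk : k ∈ D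
    · have := hDlow k hk
      have h' : ¬ (c k).rev.val < n := by rw [Fin.val_rev]; omega
      simp [hk, sqY_high Φ _ h']
    · simp [hk]
  rw [e1] at hrel
  have hfin : sqD Φ c = ((-1 : K) ^ D.card) • ((-1) ^ D.card * sqD Φ c) := by
    rcases neg_one_pow_eq_or K D.card with h | h <;>
    rcases neg_one_pow_eq_or R D.card with h' | h'
    · simp [h, h']
    · have e : ((-1 : R) ^ D.card) = algebraMap K R ((-1) ^ D.card) := by simp
      rw [e, h]; simp
    · have e : ((-1 : R) ^ D.card) = algebraMap K R ((-1) ^ D.card) := by simp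
      rw [e, h]; simp
    · simp [h, h']
  rw [hfin, ← hrel]
  apply Submodule.smul_mem
  apply Submodule.sum_mem
  intro P _
  split_ifs with hP
  swap
  · exact Submodule.zero_mem _
  obtain ⟨hdis, hcard⟩ := hP
  by_cases hlow : ∃ k ∈ P, (c k).val < n
  · obtain ⟨k, hkP, hk⟩ := hlow
    rw [Matrix.det_eq_zero_of_row_eq_zero k]
    · exact Submodule.zero_mem _
    · intro i
      have hkD : k ∉ D := Finset.disjoint_left.mp hdis hkP
      simp [hkP, hkD, sqY_low Φ h2 _ hk]
  push Not at hlow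
  set c' : Fin n → Fin (2 * n) := fun k => if k ∈ P ∨ k ∈ D then (c k).rev else c k with hc'
  have e2 : Matrix.det (Matrix.of fun k => if k ∈ P then
      Φ.mulVec (sqY Φ (if k ∈ D then (c k).rev else c k)) else
      sqY Φ (if k ∈ D then (c k).rev else c k)) = sqD Φ c' := by
    refine congrArg (fun f => Matrix.det (Matrix.of f)) (funext fun k => ?_)
    by_cases hk : k ∈ P
    · have hkD : k ∉ D := Finset.disjoint_left.mp hdis hk
      have := sqY_high Φ (c k) (by have := hlow k hk; omega)
      simp [hk, hkD, hc', this]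
    · simp [hk, hc']
  rw [e2]
  by_cases hinj : Function.Injective c'
  swap
  · rw [sqD_eq_zero _ _ hinj]; exact Submodule.zero_mem _
  apply Submodule.subset_span
  refine ⟨c', ?_, rfl⟩
  have hex : ∃ k ∈ P, c j < (c k).rev := by
    by_contra hcon
    push Not at hcon
    have hsub : P ⊆ (Finset.univ.filter fun k => (c k).rev ≤ c j ∧ ∀ l, c l ≠ (c k).rev) := by
      intro k hk
      simp only [Finset.mem_filter, Finset.mem_univ, true_and]
      refine ⟨hcon k hk, ?_⟩
      intro l hl
      have hkn := hlow k hk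
      have hln : (c l).val < n := by rw [hl, Fin.val_rev]; omega
      have hlP : l ∉ P := fun h => by have := hlow l h; omega
      have hlD : l ∉ D := by
        intro h
        have := (Finset.mem_filter.mp h).2.2 k
        rw [hl, Fin.rev_rev] at this
        exact this rfl
      have : l = k := by
        apply hinj
        simp [hc', hlP, hlD, hk, hl]
      subst this
      omega
    have h1 := Finset.card_le_card hsub
    have h2 := sq_card_lt c hc j hj
    rw [← hD] at h2
    omega
  obtain ⟨k0, hk0, hk0'⟩ := hex
  have hsum : ∑ k, (sqMu (c' k) + if k ∈ P then 2 * 2 ^ (c k).rev.val else 0) =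
      ∑ k, (sqMu (c k) + if k ∈ D then 2 * 2 ^ (c k).val else 0) := by
    refine Finset.sum_congr rfl fun k _ => ?_
    by_cases hk : k ∈ P
    · have hkD : k ∉ D := Finset.disjoint_left.mp hdis hk
      have hkn := hlow k hk
      have := sqMu_rev (c k).rev (by rw [Fin.val_rev]; omega)
      rw [Fin.rev_rev] at this
      simp [hk, hkD, hc', this]
    · by_cases hkD : k ∈ D
      · simp [hk, hkD, hc', sqMu_rev (c k) (hDlow k hkD)]
      · simp [hk, hkD, hc']
  rw [Finset.sum_add_distrib, Finset.sum_add_distrib] at hsum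
  have hPs : 2 * 2 ^ ((c j).val + 1) ≤ ∑ k, if k ∈ P then 2 * 2 ^ (c k).rev.val else 0 := by
    have h1 : 2 ^ ((c j).val + 1) ≤ 2 ^ (c k0).rev.val :=
      Nat.pow_le_pow_right (by norm_num) hk0'
    have := Finset.single_le_sum (f := fun k => if k ∈ P then 2 * 2 ^ (c k).rev.val else 0)
      (fun _ _ => Nat.zero_le _) (Finset.mem_univ k0)
    simp only [hk0, if_true] at this
    omega
  have hDs : (∑ k, if k ∈ D then 2 * 2 ^ (c k).val else 0) < 2 * 2 ^ ((c j).val + 1) := by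
    rw [← Finset.sum_filter, Finset.filter_mem_eq_inter, Finset.univ_inter, ← Finset.mul_sum]
    have h1 : ∑ k ∈ D, 2 ^ (c k).val = ∑ x ∈ D.image (fun k => (c k).val), 2 ^ x := by
      rw [Finset.sum_image]
      intro a _ b _ hab
      exact hc.injective (Fin.ext hab)
    have h2 : ∑ x ∈ D.image (fun k => (c k).val), 2 ^ x < 2 ^ ((c j).val + 1) := by
      apply Nat.geomSum_lt (by norm_num)
      intro x hx
      obtain ⟨k, hk, rfl⟩ := Finset.mem_image.mp hx
      have := (Finset.mem_filter.mp hk).2.1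
      rw [Fin.le_def] at this
      omega
    omega
  simp only [Set.mem_ofPred_eq]
  omega
end Viol

section Shuffle
variable {R : Type*} [CommRing R] {n : ℕ}

/-- The determinant as an alternating map in some of the rows. -/
def sqAlt (P : Fin n → Prop) [DecidablePred P] (z : Fin n → Fin n → R) :
    (Fin n → R) [⋀^{j // P j}]→ₗ[R] R :=
  { (Matrix.detRowAlternating (R := R) (n := Fin n)).toMultilinearMap.domDomRestrict P
      (fun j => z j.1) with
    map_eq_zero_of_eq' := by
      intro v i j hij hne
      refine (Matrix.detRowAlternating (R := R) (n := Fin n)).map_eq_zero_of_eq _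
        (i := i.1) (j := j.1) ?_ (fun h => hne (Subtype.ext h))
      simp [i.2, j.2, hij] }

lemma sqAlt_apply (P : Fin n → Prop) [DecidablePred P] (z : Fin n → Fin n → R)
    (u : {j // P j} → Fin n → R) :
    sqAlt P z u = Matrix.det (Matrix.of fun j => if h : P j then u ⟨j, h⟩ else z j) := rfl

lemma sq_sum_lt {α β : Type*} [Fintype α] [Fintype β]
    (e : α ⊕ β → ℕ) (t : ℕ) (h1 : ∀ a, t < e (Sum.inl a)) (h2 : ∀ b, e (Sum.inr b) ≤ t)
    (σ : Equiv.Perm (α ⊕ β)) (a0 : α) (b0 : β) (h0 : σ (Sum.inl a0) = Sum.inr b0) :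
    ∑ a, e (σ (Sum.inl a)) < ∑ a, e (Sum.inl a) := by
  classical
  set A : Finset (α ⊕ β) := Finset.univ.image Sum.inl with hA
  set B : Finset (α ⊕ β) := A.image σ with hB
  have s1 : ∑ a, e (Sum.inl a) = ∑ x ∈ A, e x := by
    rw [hA, Finset.sum_image (fun _ _ _ _ h => Sum.inl_injective h)]
  have s2 : ∑ a, e (σ (Sum.inl a)) = ∑ x ∈ B, e x := by
    rw [hB, Finset.sum_image (fun _ _ _ _ h => σ.injective h), hA,
      Finset.sum_image (fun _ _ _ _ h => Sum.inl_injective h)]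
  have hcard : B.card = A.card := Finset.card_image_of_injective _ σ.injective
  have hcs : (B \ A).card = (A \ B).card := by
    rw [Finset.card_sdiff_comm hcard]
  rw [s1, s2, ← Finset.sum_sdiff_lt_sum_sdiff]
  have hne : 0 < (B \ A).card := by
    refine Finset.card_pos.mpr ⟨Sum.inr b0, ?_⟩
    simp only [Finset.mem_sdiff, hB, hA, Finset.mem_image, Finset.mem_univ, true_and]
    exact ⟨⟨Sum.inl a0, ⟨a0, rfl⟩, h0⟩, by simp⟩
  have u1 : ∑ x ∈ B \ A, e x ≤ (B \ A).card • t := by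
    refine Finset.sum_le_card_nsmul _ _ _ fun x hx => ?_
    rcases x with x | x
    · simp [hA] at hx
    · exact h2 x
  have u2 : (A \ B).card • (t + 1) ≤ ∑ x ∈ A \ B, e x := by
    refine Finset.card_nsmul_le_sum _ _ _ fun x hx => ?_
    rcases x with x | x
    · exact h1 x
    · simp [hA] at hx
  rw [← hcs] at u2
  simp only [smul_eq_mul, mul_add, mul_one] at u1 u2
  omega

/-- Straightening of a product of two minors. -/
lemma sq_shuffle (K : Type*) [CommRing K] [Algebra K R] (Φ : Matrix (Fin n) (Fin n) R)
    (c d : Fin n → Fin (2 * n)) (hc : StrictMono c) (hd : StrictMono d) (j0 : Fin n)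
    (hj : d j0 < c j0) :
    sqD Φ c * sqD Φ d ∈ Submodule.span K {r : R | ∃ c' d' : Fin n → Fin (2 * n),
      (∀ f : Fin (2 * n) → ℕ, ∑ k, f (c' k) + ∑ k, f (d' k) = ∑ k, f (c k) + ∑ k, f (d k)) ∧
      ∑ k, (c' k).val < ∑ k, (c k).val ∧ r = sqD Φ c' * sqD Φ d'} := by
  classical
  let a := sqAlt (fun j => j0 ≤ j) (fun j => sqY Φ (c j))
  let b := sqAlt (fun j => j ≤ j0) (fun j => sqY Φ (d j))
  let e : {j // j0 ≤ j} ⊕ {j // j ≤ j0} → Fin (2 * n) :=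
    Sum.elim (fun j => c j.1) (fun j => d j.1)
  have hcard : n < Fintype.card ({j // j0 ≤ j} ⊕ {j // j ≤ j0}) := by
    rw [Fintype.card_sum, Fintype.card_subtype, Fintype.card_subtype]
    have h1 : Finset.univ.filter (fun j => j0 ≤ j) = Finset.Ici j0 := by ext; simp
    have h2 : Finset.univ.filter (fun j => j ≤ j0) = Finset.Iic j0 := by ext; simp
    rw [h1, h2, Fin.card_Ici, Fin.card_Iic]
    have := j0.2
    omega
  have hzero : AlternatingMap.domCoprod a b = 0 := by
    refine Module.Basis.ext_alternating (Pi.basisFun R (Fin n)) fun v hv => ?_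
    have := Fintype.card_le_of_injective v hv
    simp only [Fintype.card_fin] at this
    omega
  let C' : Equiv.Perm ({j // j0 ≤ j} ⊕ {j // j ≤ j0}) → Fin n → Fin (2 * n) := fun σ j =>
    if h : j0 ≤ j then e (σ (Sum.inl ⟨j, h⟩)) else c j
  let D' : Equiv.Perm ({j // j0 ≤ j} ⊕ {j // j ≤ j0}) → Fin n → Fin (2 * n) := fun σ j =>
    if h : j ≤ j0 then e (σ (Sum.inr ⟨j, h⟩)) else d j
  have hterm : ∀ σ, LinearMap.mul' R R
      (AlternatingMap.domCoprod.summand a b (Quotient.mk'' σ) (fun i => sqY Φ (e i))) =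
      Equiv.Perm.sign σ • (sqD Φ (C' σ) * sqD Φ (D' σ)) := by
    intro σ
    rw [AlternatingMap.domCoprod.summand_mk'']
    have h1 : a (fun i => sqY Φ (e (σ (Sum.inl i)))) = sqD Φ (C' σ) := by
      rw [sqAlt_apply]
      refine congrArg (fun f => Matrix.det (Matrix.of f)) (funext fun k => ?_)
      by_cases h : j0 ≤ k <;> simp [h, C']
    have h2 : b (fun i => sqY Φ (e (σ (Sum.inr i)))) = sqD Φ (D' σ) := by
      rw [sqAlt_apply]
      refine congrArg (fun f => Matrix.det (Matrix.of f)) (funext fun k => ?_)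
      by_cases h : k ≤ j0 <;> simp [h, D']
    have h3 : LinearMap.mul' R R ((Equiv.Perm.sign σ •
        (MultilinearMap.domCoprod (a : MultilinearMap R _ _) (b : MultilinearMap R _ _)).domDomCongr
          σ) (fun i => sqY Φ (e i))) = Equiv.Perm.sign σ • LinearMap.mul' R R
        ((a fun i => sqY Φ (e (σ (Sum.inl i)))) ⊗ₜ[R] (b fun i => sqY Φ (e (σ (Sum.inr i))))) := by
      rcases Int.units_eq_one_or (Equiv.Perm.sign σ) with h | h <;> rw [h] <;> simp
    rw [h3, h1, h2, LinearMap.mul'_apply]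
  have hsum : ∑ σ : Equiv.Perm.ModSumCongr {j // j0 ≤ j} {j // j ≤ j0}, LinearMap.mul' R R
      (AlternatingMap.domCoprod.summand a b σ (fun i => sqY Φ (e i))) = 0 := by
    have := congrArg (fun F => LinearMap.mul' R R (F (fun i => sqY Φ (e i)))) hzero
    simp only [AlternatingMap.domCoprod_apply, AlternatingMap.zero_apply, map_zero] at this
    rw [← map_sum]
    rw [← this]
    congr 1
    simp
  let q1 : Equiv.Perm.ModSumCongr {j // j0 ≤ j} {j // j ≤ j0} := Quotient.mk'' 1
  have hsum2 := Finset.add_sum_erase Finset.univ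
    (fun σ : Equiv.Perm.ModSumCongr {j // j0 ≤ j} {j // j ≤ j0} => LinearMap.mul' R R
      (AlternatingMap.domCoprod.summand a b σ (fun i => sqY Φ (e i)))) (Finset.mem_univ q1)
  rw [hsum] at hsum2
  replace hsum := hsum2
  beta_reduce at hsum
  rw [hterm] at hsum
  have hC1 : C' 1 = c := by
    funext j; simp [C', e]
  have hD1 : D' 1 = d := by
    funext j; simp [D', e]
  rw [hC1, hD1, Equiv.Perm.sign_one, one_smul] at hsum
  rw [eq_neg_of_add_eq_zero_left hsum]
  refine Submodule.neg_mem _ (Submodule.sum_mem _ fun q hq => ?_)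
  induction q using Quotient.inductionOn' with
  | _ σ =>
  rw [hterm]
  have hmem : sqD Φ (C' σ) * sqD Φ (D' σ) ∈ Submodule.span K {r : R | ∃ c' d' : Fin n → Fin (2 * n),
      (∀ f : Fin (2 * n) → ℕ, ∑ k, f (c' k) + ∑ k, f (d' k) = ∑ k, f (c k) + ∑ k, f (d k)) ∧
      ∑ k, (c' k).val < ∑ k, (c k).val ∧ r = sqD Φ c' * sqD Φ d'} := by
    refine Submodule.subset_span ⟨C' σ, D' σ, ?_, ?_, rfl⟩
    · intro f
      have hs : ∀ τ : Equiv.Perm ({j // j0 ≤ j} ⊕ {j // j ≤ j0}),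
          ∑ k, f (C' τ k) + ∑ k, f (D' τ k) = ∑ x, f (e x) +
            (∑ k : {j // ¬ j0 ≤ j}, f (c k) + ∑ k : {j // ¬ j ≤ j0}, f (d k)) := by
        intro τ
        rw [← Equiv.sum_comp τ, Fintype.sum_sum_type,
          ← Fintype.sum_subtype_add_sum_subtype (fun j => j0 ≤ j) (fun k => f (C' τ k)),
          ← Fintype.sum_subtype_add_sum_subtype (fun j => j ≤ j0) (fun k => f (D' τ k))]
        have e1 : ∀ k : {j // j0 ≤ j}, C' τ k.1 = e (τ (Sum.inl k)) := fun k => dif_pos k.2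
        have e2 : ∀ k : {j // ¬ j0 ≤ j}, C' τ k.1 = c k := fun k => dif_neg k.2
        have e3 : ∀ k : {j // j ≤ j0}, D' τ k.1 = e (τ (Sum.inr k)) := fun k => dif_pos k.2
        have e4 : ∀ k : {j // ¬ j ≤ j0}, D' τ k.1 = d k := fun k => dif_neg k.2
        simp only [e1, e2, e3, e4]
        omega
      rw [hs σ, ← hs 1, hC1, hD1]
    · rw [← Fintype.sum_subtype_add_sum_subtype (fun j => j0 ≤ j) (fun k => (C' σ k).val),
          ← Fintype.sum_subtype_add_sum_subtype (fun j => j0 ≤ j) (fun k => (c k).val)]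
      have e1 : ∀ k : {j // j0 ≤ j}, C' σ k.1 = e (σ (Sum.inl k)) := fun k => dif_pos k.2
      have e2 : ∀ k : {j // ¬ j0 ≤ j}, C' σ k.1 = c k := fun k => dif_neg k.2
      simp only [e1, e2]
      refine Nat.add_lt_add_right ?_ _
      have hne : ∃ a0 b0, σ (Sum.inl a0) = Sum.inr b0 := by
        by_contra hcon
        push Not at hcon
        apply (Finset.mem_erase.mp hq).1
        apply Quotient.sound'
        rw [QuotientGroup.leftRel_apply]
        have : σ ∈ (Equiv.Perm.sumCongrHom {j // j0 ≤ j} {j // j ≤ j0}).range := by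
          apply Equiv.Perm.mem_sumCongrHom_range_of_perm_mapsTo_inl
          rintro _ ⟨x, rfl⟩
          rcases hx : σ (Sum.inl x) with y | y
          · exact ⟨y, rfl⟩
          · exact absurd hx (hcon x y)
        simpa using Subgroup.inv_mem _ this
      obtain ⟨a0, b0, h0⟩ := hne
      refine sq_sum_lt (fun x => (e x).val) (d j0).val ?_ ?_ σ a0 b0 h0
      · intro x
        exact lt_of_lt_of_le hj (hc.monotone x.2)
      · intro x
        exact hd.monotone x.2
  rcases Int.units_eq_one_or (Equiv.Perm.sign σ) with h | h <;> rw [h]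
  · simpa using hmem
  · simpa using hmem
end Shuffle

/-- Rational standard tableaux. -/
structure SqStd {m n : ℕ} (c : Fin m → Fin n → Fin (2 * n)) : Prop where
  row : ∀ p, StrictMono (c p)
  col : ∀ p q, p < q → ∀ j, c p j ≤ c q j
  rat : ∀ p j, 2 * n - 1 ≤ (c p j).val + (c p j.rev).val

section Straight
variable {R : Type*} [CommRing R] {n m : ℕ}

/-- Product of minors of a tableau. -/
def sqProd (Φ : Matrix (Fin n) (Fin n) R) (c : Fin m → Fin n → Fin (2 * n)) : R :=
  ∏ p, sqD Φ (c p)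

/-- First measure of a tableau. -/
def sqM1 (c : Fin m → Fin n → Fin (2 * n)) : ℕ := ∑ p, ∑ j, sqMu (c p j)

/-- Second measure of a tableau. -/
def sqM2 (c : Fin m → Fin n → Fin (2 * n)) : ℕ := ∑ p : Fin m, (m - p.val) * ∑ j, (c p j).val

lemma sqD_perm (Φ : Matrix (Fin n) (Fin n) R) (c : Fin n → Fin (2 * n))
    (σ : Equiv.Perm (Fin n)) :
    sqD Φ (c ∘ σ) = ((Equiv.Perm.sign σ : ℤ) : R) * sqD Φ c := by
  unfold sqD
  rw [← Matrix.det_permute]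
  rfl

lemma sq_sort (c : Fin n → Fin (2 * n)) (hc : Function.Injective c) :
    StrictMono (c ∘ Tuple.sort c) :=
  (Tuple.monotone_sort c).strictMono_of_injective (hc.comp (Tuple.sort c).injective)

lemma sq_step (K : Type*) [CommRing K] [Algebra K R] (Φ : Matrix (Fin n) (Fin n) R)
    (h2 : Φ * Φ = 0)
    (hd : Matrix.det (1 + (Polynomial.X : Polynomial R) • Φ.map Polynomial.C) = 1)
    (W : Submodule K R)
    (hW : ∀ T : Fin m → Fin n → Fin (2 * n), SqStd T → sqProd Φ T ∈ W)
    (c : Fin m → Fin n → Fin (2 * n)) (hrow : ∀ p, StrictMono (c p))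
    (ih : ∀ c' : Fin m → Fin n → Fin (2 * n), sqM1 c' < sqM1 c ∨
      (sqM1 c' = sqM1 c ∧ sqM2 c' < sqM2 c) → sqProd Φ c' ∈ W) :
    sqProd Φ c ∈ W := by
  by_cases hrat : ∀ p j, 2 * n - 1 ≤ (c p j).val + (c p j.rev).val
  · by_cases hcol : ∀ p q, p < q → ∀ j, c p j ≤ c q j
    · exact hW c ⟨hrow, hcol, hrat⟩
    · push Not at hcol
      obtain ⟨p, q, hpq, j, hj⟩ := hcol
      have hs := sq_shuffle K Φ (c p) (c q) (hrow p) (hrow q) j hj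
      have hq : q ∈ Finset.univ.erase p := Finset.mem_erase.mpr ⟨hpq.ne', Finset.mem_univ _⟩
      have split : ∀ {N : Type _} [CommMonoid N] (f : Fin m → N),
          ∏ x, f x = f p * f q * ∏ x ∈ (Finset.univ.erase p).erase q, f x := by
        intro N _ f
        rw [← Finset.mul_prod_erase _ _ (Finset.mem_univ p), ← Finset.mul_prod_erase _ _ hq,
          mul_assoc]
      have split' : ∀ (f : Fin m → ℕ),
          ∑ x, f x = f p + f q + ∑ x ∈ (Finset.univ.erase p).erase q, f x := by
        intro f
        rw [← Finset.add_sum_erase _ _ (Finset.mem_univ p), ← Finset.add_sum_erase _ _ hq,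
          add_assoc]
      have hle : Submodule.span K {r : R | ∃ c' d' : Fin n → Fin (2 * n),
          (∀ f : Fin (2 * n) → ℕ, ∑ k, f (c' k) + ∑ k, f (d' k) =
            ∑ k, f (c p k) + ∑ k, f (c q k)) ∧
          ∑ k, (c' k).val < ∑ k, (c p k).val ∧ r = sqD Φ c' * sqD Φ d'} ≤
          W.comap (LinearMap.mulRight K (∏ x ∈ (Finset.univ.erase p).erase q, sqD Φ (c x))) := by
        rw [Submodule.span_le]
        rintro r ⟨c', d', hf, hlt, rfl⟩
        simp only [SetLike.mem_coe, Submodule.mem_comap, LinearMap.mulRight_apply]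
        set e := Function.update (Function.update c p c') q d' with he
        have ep : e p = c' := by simp [he, hpq.ne]
        have eq : e q = d' := by simp [he]
        have ex : ∀ x ∈ (Finset.univ.erase p).erase q, e x = c x := by
          intro x hx
          simp only [Finset.mem_erase] at hx
          simp [he, hx.1, hx.2.1]
        have hp : sqProd Φ e = sqD Φ c' * sqD Φ d' *
            ∏ x ∈ (Finset.univ.erase p).erase q, sqD Φ (c x) := by
          unfold sqProd
          rw [split (fun x => sqD Φ (e x)), ep, eq]
          congr 1
          exact Finset.prod_congr rfl fun x hx => by rw [ex x hx]
        rw [← hp]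
        apply ih
        right
        constructor
        · unfold sqM1
          rw [split', split' (fun p => ∑ j, sqMu (c p j)), ep, eq, hf sqMu]
          congr 1
          exact Finset.sum_congr rfl fun x hx => by rw [ex x hx]
        · unfold sqM2
          rw [split', split' (fun p : Fin m => (m - p.val) * ∑ j, (c p j).val), ep, eq]
          refine Nat.add_lt_add_of_lt_of_le ?_
            (Finset.sum_congr rfl fun x hx => by rw [ex x hx]).le
          have h1 := hf (fun x => x.val)
          beta_reduce at h1
          generalize ∑ k, (c' k).val = s1 at *
          generalize ∑ k, (d' k).val = s2 at *
          generalize ∑ k, (c p k).val = s3 at *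
          generalize ∑ k, (c q k).val = s4 at *
          obtain ⟨δ, rfl⟩ := Nat.exists_eq_add_of_lt hlt
          obtain rfl : s2 = s4 + (δ + 1) := by omega
          have hpq' : p.val < q.val := hpq
          have hq2 := q.2
          obtain ⟨w, hw⟩ : ∃ w, m - p.val = (m - q.val) + w + 1 := ⟨q.val - p.val - 1, by omega⟩
          rw [hw]
          nlinarith
      have := hle hs
      simp only [Submodule.mem_comap, LinearMap.mulRight_apply] at this
      unfold sqProd
      rwa [split (fun x => sqD Φ (c x))]
  · push Not at hrat
    obtain ⟨p, j, hj⟩ := hrat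
    have hs := sqD_viol K Φ h2 hd (c p) (hrow p) j hj
    have hle : Submodule.span K (sqD Φ '' {c' | ∑ k, sqMu (c' k) < ∑ k, sqMu (c p k)}) ≤
        W.comap (LinearMap.mulRight K (∏ x ∈ Finset.univ.erase p, sqD Φ (c x))) := by
      rw [Submodule.span_le]
      rintro r ⟨c', hlt, rfl⟩
      simp only [SetLike.mem_coe, Submodule.mem_comap, LinearMap.mulRight_apply]
      set e := Function.update c p c' with he
      have ep : e p = c' := by simp [he]
      have ex : ∀ x ∈ Finset.univ.erase p, e x = c x := by
        intro x hx
        simp only [Finset.mem_erase] at hx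
        simp [he, hx.1]
      have hp : sqProd Φ e = sqD Φ c' * ∏ x ∈ Finset.univ.erase p, sqD Φ (c x) := by
        unfold sqProd
        rw [← Finset.mul_prod_erase _ _ (Finset.mem_univ p), ep]
        congr 1
        exact Finset.prod_congr rfl fun x hx => by rw [ex x hx]
      rw [← hp]
      apply ih
      left
      unfold sqM1
      rw [← Finset.add_sum_erase _ _ (Finset.mem_univ p),
        ← Finset.add_sum_erase _ (fun p => ∑ j, sqMu (c p j)) (Finset.mem_univ p), ep]
      exact Nat.add_lt_add_of_lt_of_le hlt
        (Finset.sum_congr rfl fun x hx => by rw [ex x hx]).le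
    have := hle hs
    simp only [Submodule.mem_comap, LinearMap.mulRight_apply] at this
    unfold sqProd
    rwa [← Finset.mul_prod_erase _ _ (Finset.mem_univ p)]

lemma sq_straight (K : Type*) [CommRing K] [Algebra K R] (Φ : Matrix (Fin n) (Fin n) R)
    (h2 : Φ * Φ = 0)
    (hd : Matrix.det (1 + (Polynomial.X : Polynomial R) • Φ.map Polynomial.C) = 1)
    (W : Submodule K R)
    (hW : ∀ T : Fin m → Fin n → Fin (2 * n), SqStd T → sqProd Φ T ∈ W) :
    ∀ (a b : ℕ) (c : Fin m → Fin n → Fin (2 * n)), sqM1 c = a → sqM2 c = b →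
      sqProd Φ c ∈ W := by
  intro a
  induction a using Nat.strong_induction_on with
  | _ a iha =>
  intro b
  induction b using Nat.strong_induction_on with
  | _ b ihb =>
  intro c ha hb
  by_cases hinj : ∀ p, Function.Injective (c p)
  · let c' : Fin m → Fin n → Fin (2 * n) := fun p => c p ∘ Tuple.sort (c p)
    have m1 : sqM1 c' = sqM1 c := by
      unfold sqM1
      refine Finset.sum_congr rfl fun p _ => ?_
      exact Equiv.sum_comp (Tuple.sort (c p)) (fun j => sqMu (c p j))
    have m2 : sqM2 c' = sqM2 c := by
      unfold sqM2
      refine Finset.sum_congr rfl fun p _ => ?_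
      congr 1
      exact Equiv.sum_comp (Tuple.sort (c p)) (fun j => (c p j).val)
    have h := sq_step K Φ h2 hd W hW c' (fun p => sq_sort _ (hinj p)) (by
      rw [m1, m2, ha, hb]
      rintro e (he | ⟨he, he'⟩)
      · exact iha _ he _ e rfl rfl
      · exact ihb _ he' e he rfl)
    have hp : sqProd Φ c' = ((∏ p, (Equiv.Perm.sign (Tuple.sort (c p))) : ℤˣ) : ℤ) •
        sqProd Φ c := by
      unfold sqProd
      rw [zsmul_eq_mul]
      push_cast
      rw [← Finset.prod_mul_distrib]
      refine Finset.prod_congr rfl fun p _ => sqD_perm _ _ _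
    rw [hp] at h
    rcases Int.units_eq_one_or (∏ p, (Equiv.Perm.sign (Tuple.sort (c p)))) with h' | h' <;>
      rw [h'] at h
    · simpa using h
    · simpa using h
  · push Not at hinj
    obtain ⟨p, hp⟩ := hinj
    have : sqProd Φ c = 0 := Finset.prod_eq_zero (Finset.mem_univ p) (sqD_eq_zero _ _ hp)
    rw [this]
    exact W.zero_mem

end Straight

section Gen
variable {R : Type*} [CommRing R] {n : ℕ}

lemma sqY_top (Φ : Matrix (Fin n) (Fin n) R) (k : Fin n) (h : 2 * n - 1 - k.val < 2 * n) :
    sqY Φ ⟨2 * n - 1 - k.val, h⟩ = Pi.single k 1 := by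
  have hk := k.2
  have h1 : ¬ (2 * n - 1 - k.val < n) := by omega
  simp only [sqY, h1, dif_neg, not_false_eq_true]
  congr 1
  ext
  simp
  omega

lemma sqD_one (Φ : Matrix (Fin n) (Fin n) R) :
    sqD Φ (fun k => ⟨2 * n - 1 - k.val, by have := k.2; omega⟩) = 1 := by
  unfold sqD
  simp only [sqY_top]
  rw [← Matrix.det_one (n := Fin n) (R := R)]
  congr 1
  ext i j
  simp [Matrix.one_apply, Pi.single_apply, eq_comm]

lemma sqD_entry (Φ : Matrix (Fin n) (Fin n) R) (i j : Fin n) :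
    sqD Φ (Function.update (fun k => ⟨2 * n - 1 - k.val, by have := k.2; omega⟩) i
      ⟨j.val, by have := j.2; omega⟩) = Φ i j := by
  have h : (Matrix.of fun k => sqY Φ (Function.update
      (fun k => ⟨2 * n - 1 - k.val, by have := k.2; omega⟩ : Fin n → Fin (2 * n)) i
      ⟨j.val, by have := j.2; omega⟩ k)) = (1 : Matrix (Fin n) (Fin n) R).updateRow i
        (fun k => Φ k j) := by
    ext a b
    by_cases hai : a = i
    · subst hai
      simp [sqY]
    · simp only [Matrix.of_apply, Function.update_of_ne hai, sqY_top]
      rw [Matrix.updateRow_ne hai]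
      simp [Matrix.one_apply, Pi.single_apply, eq_comm]
  unfold sqD
  rw [h, ← Matrix.cramer_transpose_apply, Matrix.transpose_one, Matrix.cramer_one]
  rfl

lemma sq_gen (K : Type*) [CommRing K] (f : MvPolynomial (Fin n × Fin n) K) :
    ∃ m : ℕ, f ∈ Submodule.span K (Set.range fun c : Fin m → Fin n → Fin (2 * n) =>
      sqProd (Matrix.of fun i j => (MvPolynomial.X (i, j) : MvPolynomial (Fin n × Fin n) K)) c) := by
  set Φ : Matrix (Fin n) (Fin n) (MvPolynomial (Fin n × Fin n) K) :=
    Matrix.of fun i j => MvPolynomial.X (i, j) with hΦ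
  set P := Submodule.span K (Set.range (sqD Φ)) with hP
  have h1 : (1 : Submodule K (MvPolynomial (Fin n × Fin n) K)) ≤ P := by
    rw [Submodule.one_le]
    exact Submodule.subset_span ⟨_, sqD_one Φ⟩
  have hmono : ∀ a b : ℕ, a ≤ b → P ^ a ≤ P ^ b := fun a b hab =>
    pow_le_pow_right' h1 hab
  have hmem : ∃ m : ℕ, f ∈ P ^ m := by
    induction f using MvPolynomial.induction_on with
    | C a =>
      refine ⟨0, ?_⟩
      rw [pow_zero]
      exact Submodule.mem_one.mpr ⟨a, rfl⟩
    | add p q hp hq =>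
      obtain ⟨a, ha⟩ := hp
      obtain ⟨b, hb⟩ := hq
      exact ⟨max a b, Submodule.add_mem _ (hmono _ _ (le_max_left _ _) ha)
        (hmono _ _ (le_max_right _ _) hb)⟩
    | mul_X p x hp =>
      obtain ⟨a, ha⟩ := hp
      refine ⟨a + 1, ?_⟩
      rw [pow_succ]
      refine Submodule.mul_mem_mul ha (Submodule.subset_span ⟨_, sqD_entry Φ x.1 x.2⟩)
  obtain ⟨m, hm⟩ := hmem
  refine ⟨m, ?_⟩
  rw [hP, Submodule.span_pow] at hm
  refine Submodule.span_mono ?_ hm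
  intro g hg
  rw [Set.mem_pow] at hg
  obtain ⟨F, rfl⟩ := hg
  choose c hc using fun p => (F p).2
  refine ⟨c, ?_⟩
  simp only [sqProd, List.prod_ofFn, hc]
end Gen

section Lead
variable {K : Type*} [Field K] {σ : Type*}

/-- The exponent `s` is the unique exponent of minimal weight of `P`. -/
def SqLead (w : σ → ℕ) (P : MvPolynomial σ K) (s : σ →₀ ℕ) : Prop :=
  MvPolynomial.coeff s P ≠ 0 ∧
    ∀ t, MvPolynomial.coeff t P ≠ 0 → t = s ∨ Finsupp.weight w s < Finsupp.weight w t

lemma SqLead.le {w : σ → ℕ} {P : MvPolynomial σ K} {s : σ →₀ ℕ} (h : SqLead w P s)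
    (t : σ →₀ ℕ) (ht : MvPolynomial.coeff t P ≠ 0) :
    Finsupp.weight w s ≤ Finsupp.weight w t := by
  rcases h.2 t ht with rfl | h
  · exact le_rfl
  · exact h.le

lemma sqLead_one (w : σ → ℕ) : SqLead w (1 : MvPolynomial σ K) 0 := by
  classical
  refine ⟨by simp, fun t ht => ?_⟩
  left
  by_contra h
  apply ht
  rw [MvPolynomial.coeff_one, if_neg (fun h' => h h'.symm)]

lemma SqLead.mul {w : σ → ℕ} {P Q : MvPolynomial σ K} {s t : σ →₀ ℕ} (hP : SqLead w P s)
    (hQ : SqLead w Q t) : SqLead w (P * Q) (s + t) := by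
  classical
  have key : ∀ a b, MvPolynomial.coeff a P ≠ 0 → MvPolynomial.coeff b Q ≠ 0 →
      (a = s ∧ b = t) ∨ Finsupp.weight w (s + t) < Finsupp.weight w (a + b) := by
    intro a b ha hb
    have h1 := hP.le a ha
    have h2 := hQ.le b hb
    simp only [map_add]
    rcases hP.2 a ha with rfl | h
    · rcases hQ.2 b hb with rfl | h
      · exact Or.inl ⟨rfl, rfl⟩
      · right; omega
    · right; omega
  constructor
  · rw [MvPolynomial.coeff_mul, Finset.sum_eq_single (s, t)]
    · exact mul_ne_zero hP.1 hQ.1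
    · rintro ⟨a, b⟩ hab hne
      rw [Finset.HasAntidiagonal.mem_antidiagonal] at hab
      by_contra h
      rcases key a b (left_ne_zero_of_mul h) (right_ne_zero_of_mul h) with h' | h'
      · exact hne (by rw [h'.1, h'.2])
      · simp only at hab
        rw [hab] at h'
        exact lt_irrefl _ h'
    · intro h
      exact absurd (by rw [Finset.HasAntidiagonal.mem_antidiagonal]) h
  · intro r hr
    rw [MvPolynomial.coeff_mul] at hr
    obtain ⟨⟨a, b⟩, hab, h⟩ := Finset.exists_ne_zero_of_sum_ne_zero hr
    rw [Finset.HasAntidiagonal.mem_antidiagonal] at hab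
    simp only at hab
    rcases key a b (left_ne_zero_of_mul h) (right_ne_zero_of_mul h) with h' | h'
    · left; rw [← hab, h'.1, h'.2]
    · right; rwa [hab] at h'

lemma sqLead_prod {ι : Type*} (w : σ → ℕ) (A : Finset ι) (P : ι → MvPolynomial σ K)
    (s : ι → σ →₀ ℕ) (h : ∀ i ∈ A, SqLead w (P i) (s i)) :
    SqLead w (∏ i ∈ A, P i) (∑ i ∈ A, s i) := by
  classical
  induction A using Finset.induction_on with
  | empty => simpa using sqLead_one w
  | insert a A ha ih =>
    rw [Finset.prod_insert ha, Finset.sum_insert ha]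
    exact (h a (Finset.mem_insert_self _ _)).mul
      (ih fun i hi => h i (Finset.mem_insert_of_mem hi))

lemma sqLead_indep {ι : Type*} [Fintype ι] (w : σ → ℕ) (P : ι → MvPolynomial σ K)
    (s : ι → σ →₀ ℕ) (h : ∀ i, SqLead w (P i) (s i)) (hs : Function.Injective s)
    (a : ι → K) (h0 : ∑ i, a i • P i = 0) : ∀ i, a i = 0 := by
  classical
  by_contra hcon
  push Not at hcon
  obtain ⟨i, hi, hmin⟩ := (Finset.univ.filter fun i => a i ≠ 0).exists_min_image
    (fun i => Finsupp.weight w (s i)) (by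
      obtain ⟨i, hi⟩ := hcon
      exact ⟨i, by simpa using hi⟩)
  simp only [Finset.mem_filter, Finset.mem_univ, true_and] at hi hmin
  have hc := congrArg (MvPolynomial.coeff (s i)) h0
  rw [MvPolynomial.coeff_sum, Finset.sum_eq_single i] at hc
  · rw [MvPolynomial.coeff_smul, smul_eq_mul, MvPolynomial.coeff_zero] at hc
    exact (mul_ne_zero hi (h i).1) hc
  · intro j _ hji
    rw [MvPolynomial.coeff_smul, smul_eq_mul]
    by_contra hne
    have hj := left_ne_zero_of_mul hne
    rcases (h j).2 _ (right_ne_zero_of_mul hne) with h' | h'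
    · exact hji (hs h').symm
    · exact absurd (hmin j hj) (not_le.mpr h')
  · simp
end Lead

section Z
variable {S : Type*} [CommRing S] {n : ℕ}

/-- The matrix `[N H | H J]`, up to ordering. -/
def sqZ (H : Matrix (Fin n) (Fin n) S) (u : Fin n) (x : Fin (2 * n)) : S :=
  if h : x.val < n then (if u.val < n / 2 then H u.rev ⟨x.val, h⟩ else 0)
  else H u ⟨2 * n - 1 - x.val, by omega⟩

/-- The variable occurring in an entry of `sqZ`. -/
def sqVar (u : Fin n) (x : Fin (2 * n)) : Fin n × Fin n :=
  if h : x.val < n then (u.rev, ⟨x.val, h⟩) else (u, ⟨2 * n - 1 - x.val, by omega⟩)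

/-- Weight of the variables. -/
def sqW (v : Fin n × Fin n) : ℕ := (n - 1 - v.1.val) * (n - v.2.val)

/-- Auxiliary increasing function. -/
def sqPhi (x : Fin (2 * n)) : ℤ := if x.val < n then (x.val : ℤ) - n else (x.val : ℤ) - n + 1

/-- Auxiliary function. -/
def sqPsi (x : Fin (2 * n)) : ℤ :=
  if x.val < n then 0 else ((n : ℤ) - 1) * ((x.val : ℤ) - n + 1)

lemma sqPhi_strictMono : StrictMono (sqPhi (n := n)) := by
  intro x y hxy
  have : x.val < y.val := hxy
  unfold sqPhi
  split_ifs <;> omega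

lemma sqW_var (u : Fin n) (x : Fin (2 * n)) :
    (sqW (sqVar u x) : ℤ) = sqPsi x - (u.val : ℤ) * sqPhi x := by
  have hu := u.2
  unfold sqW sqVar sqPsi sqPhi
  split_ifs with h
  · have e1 : n - 1 - (u.rev).val = u.val := by rw [Fin.val_rev]; omega
    simp only [e1]
    push_cast [h.le]
    ring
  · have e1 : n - (2 * n - 1 - x.val) = x.val + 1 - n := by omega
    simp only [e1]
    rw [Nat.cast_mul, Nat.cast_sub (by omega), Nat.cast_sub (by omega), Nat.cast_sub (by omega)]
    push_cast
    ring

lemma sq_perm_lt (c : Fin n → Fin (2 * n)) (hc : StrictMono c) (σ : Equiv.Perm (Fin n))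
    (hσ : σ ≠ 1) :
    ∑ j, sqW (sqVar j (c j)) < ∑ j, sqW (sqVar j (c (σ j))) := by
  zify
  simp only [sqW_var, Finset.sum_sub_distrib]
  rw [Equiv.sum_comp σ (fun j => sqPsi (c j))]
  refine sub_lt_sub_left ?_ _
  have hg : StrictMono (fun j => sqPhi (c j)) := sqPhi_strictMono.comp hc
  have hf : StrictMono (fun j : Fin n => (j.val : ℤ)) := fun a b hab => by
    simpa using hab
  have hm : Monovary (fun j : Fin n => (j.val : ℤ)) (fun j => sqPhi (c j)) :=
    hf.monotone.monovary hg.monotone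
  refine hm.sum_mul_comp_perm_lt_sum_mul_iff.mpr fun hmv => hσ ?_
  have hmono : StrictMono σ.symm := by
    intro a b hab
    have h1 := @hmv (σ.symm a) (σ.symm b) (by simpa using hg hab)
    have h2 : σ.symm a ≤ σ.symm b := by simpa using h1
    exact lt_of_le_of_ne h2 (fun h => hab.ne (σ.symm.injective h))
  have : (σ.symm : Fin n → Fin n) = id :=
    (StrictMono.range_inj hmono strictMono_id).mp (by simp)
  ext x
  have h := congrFun this (σ x)
  simp only [Equiv.symm_apply_apply, id_eq] at h
  simp [← h]

variable {K : Type*} [Field K]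

/-- Generic matrix used for the leading terms. -/
noncomputable def sqH (K : Type*) [Field K] (n : ℕ) :
    Matrix (Fin n) (Fin n) (MvPolynomial (Fin n × Fin n) K) :=
  Matrix.of fun i j => MvPolynomial.X (i, j)

/-- Leading exponent of a row. -/
noncomputable def sqExp (c : Fin n → Fin (2 * n)) : (Fin n × Fin n) →₀ ℕ :=
  ∑ j, Finsupp.single (sqVar j (c j)) 1

lemma sqExp_weight (w : Fin n × Fin n → ℕ) (c : Fin n → Fin (2 * n)) :
    Finsupp.weight w (sqExp c) = ∑ j, w (sqVar j (c j)) := by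
  unfold sqExp
  rw [map_sum]
  simp [Finsupp.weight_single]

lemma sqZ_gen (u : Fin n) (x : Fin (2 * n)) : sqZ (sqH K n) u x =
    (if x.val < n → u.val < n / 2 then MvPolynomial.X (sqVar u x) else 0) := by
  unfold sqZ sqVar sqH
  split_ifs with h1 h2 h3 h4 <;> simp_all

lemma sq_det_lead (c : Fin n → Fin (2 * n)) (hc : StrictMono c)
    (hr : ∀ j, 2 * n - 1 ≤ (c j).val + (c j.rev).val) :
    SqLead sqW (Matrix.det (Matrix.of fun j u => sqZ (sqH K n) u (c j))) (sqExp c) := by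
  classical
  have hterm : ∀ σ : Equiv.Perm (Fin n), ∏ j, sqZ (sqH K n) j (c (σ j)) =
      if ∀ j, (c (σ j)).val < n → j.val < n / 2 then
        MvPolynomial.monomial (sqExp (c ∘ σ)) (1 : K) else 0 := by
    intro σ
    split_ifs with h
    · unfold sqExp
      rw [MvPolynomial.monomial_sum_one]
      refine Finset.prod_congr rfl fun j _ => ?_
      rw [sqZ_gen, if_pos (h j)]
      rfl
    · rw [not_forall] at h
      obtain ⟨j, hj⟩ := h
      refine Finset.prod_eq_zero (Finset.mem_univ j) ?_
      rw [sqZ_gen, if_neg hj]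
  have hdiag : ∀ j, (c j).val < n → j.val < n / 2 := by
    intro j hj
    by_contra hcon
    have h1 : c j.rev ≤ c j := hc.monotone (by
      rw [Fin.le_def, Fin.val_rev]
      omega)
    have h2 : (c j.rev).val ≤ (c j).val := h1
    have := hr j
    omega
  rw [Matrix.det_apply]
  simp only [Matrix.of_apply, hterm]
  have hco : ∀ (t : (Fin n × Fin n) →₀ ℕ) (σ : Equiv.Perm (Fin n)), MvPolynomial.coeff t
      (Equiv.Perm.sign σ • (if ∀ j, (c (σ j)).val < n → j.val < n / 2 then
        MvPolynomial.monomial (sqExp (c ∘ σ)) (1 : K) else 0)) ≠ 0 → t = sqExp (c ∘ σ) := by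
    intro t σ h
    by_contra hne
    apply h
    rcases Int.units_eq_one_or (Equiv.Perm.sign σ) with h' | h' <;> rw [h'] <;> split_ifs <;>
      simp [MvPolynomial.coeff_monomial, Ne.symm hne]
  constructor
  · rw [MvPolynomial.coeff_sum, Finset.sum_eq_single 1]
    · rw [if_pos (by simpa using hdiag)]
      simp [MvPolynomial.coeff_monomial]
    · intro σ _ hσ
      by_contra h
      have h1 := congrArg (Finsupp.weight sqW) (hco _ _ h)
      rw [sqExp_weight, sqExp_weight] at h1
      have := sq_perm_lt c hc σ hσ
      simp only [Function.comp_apply] at h1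
      omega
    · simp
  · intro t ht
    rw [MvPolynomial.coeff_sum] at ht
    obtain ⟨σ, _, h⟩ := Finset.exists_ne_zero_of_sum_ne_zero ht
    rw [hco _ _ h]
    by_cases hσ : σ = 1
    · left; rw [hσ]; rfl
    · right
      rw [sqExp_weight, sqExp_weight]
      exact sq_perm_lt c hc σ hσ
end Z

section Inj
variable {n m : ℕ}

lemma sq_count_row (c : Fin n → Fin (2 * n)) (ρ : Fin n) (x : ℕ) (hx : x < n) :
    Finsupp.weight (fun v : Fin n × Fin n => if v.1 = ρ.rev ∧ v.2.val ≤ x then 1 else 0)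
      (sqExp c) = (if (c ρ).val ≤ x then 1 else 0) +
        (if 2 * n - 1 - x ≤ (c ρ.rev).val then 1 else 0) := by
  rw [sqExp_weight]
  have h : ∀ j, (if (sqVar j (c j)).1 = ρ.rev ∧ (sqVar j (c j)).2.val ≤ x then 1 else 0) =
      (if j = ρ then (if (c j).val ≤ x then 1 else 0) else 0) +
      (if j = ρ.rev then (if 2 * n - 1 - x ≤ (c j).val then 1 else 0) else 0) := by
    intro j
    unfold sqVar
    by_cases hj : (c j).val < n
    · have h1 : ¬ (2 * n - 1 - x ≤ (c j).val) := by omega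
      simp only [hj, dif_pos, Fin.rev_inj, h1, if_false]
      by_cases h2 : j = ρ <;> simp [h2]
    · have h1 : ¬ ((c j).val ≤ x) := by omega
      have h3 : 2 * n - 1 - (c j).val ≤ x ↔ 2 * n - 1 - x ≤ (c j).val := by
        have := (c j).2
        omega
      simp only [hj, dif_neg, not_false_eq_true, h1, if_false, h3]
      by_cases h2 : j = ρ.rev <;> simp [h2]
  simp only [h, Finset.sum_add_distrib, Finset.sum_ite_eq', Finset.mem_univ, if_true]

/-- Leading exponent of a tableau. -/
noncomputable def sqExpT (c : Fin m → Fin n → Fin (2 * n)) : (Fin n × Fin n) →₀ ℕ :=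
  ∑ p, sqExp (c p)

/-- Number of small entries in a column. -/
def sqA (c : Fin m → Fin n → Fin (2 * n)) (ρ : Fin n) (x : ℕ) : ℕ :=
  (Finset.univ.filter fun p => (c p ρ).val ≤ x).card

/-- Number of large entries in a column. -/
def sqB (c : Fin m → Fin n → Fin (2 * n)) (ρ : Fin n) (x : ℕ) : ℕ :=
  (Finset.univ.filter fun p => 2 * n - 1 - x ≤ (c p ρ).val).card

lemma sq_count (c : Fin m → Fin n → Fin (2 * n)) (ρ : Fin n) (x : ℕ) (hx : x < n) :
    Finsupp.weight (fun v : Fin n × Fin n => if v.1 = ρ.rev ∧ v.2.val ≤ x then 1 else 0)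
      (sqExpT c) = sqA c ρ x + sqB c ρ.rev x := by
  unfold sqExpT sqA sqB
  rw [map_sum, Finset.card_filter, Finset.card_filter, ← Finset.sum_add_distrib]
  exact Finset.sum_congr rfl fun p _ => sq_count_row _ _ _ hx

lemma sqB_le (c : Fin m → Fin n → Fin (2 * n)) (ρ : Fin n) (x : ℕ) : sqB c ρ x ≤ m := by
  have := Finset.card_filter_le (Finset.univ : Finset (Fin m))
    (fun p => 2 * n - 1 - x ≤ (c p ρ).val)
  simpa [sqB] using this

lemma SqStd.mono {c : Fin m → Fin n → Fin (2 * n)} (hc : SqStd c) (ρ : Fin n) {p q : Fin m}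
    (h : p ≤ q) : (c p ρ).val ≤ (c q ρ).val := by
  rcases h.lt_or_eq with h | rfl
  · exact hc.col p q h ρ
  · exact le_rfl

lemma sq_AB (c : Fin m → Fin n → Fin (2 * n)) (hc : SqStd c) (ρ : Fin n) (x : ℕ) :
    sqA c ρ x = 0 ∨ sqB c ρ.rev x = m := by
  by_cases h : sqA c ρ x = 0
  · exact Or.inl h
  · right
    obtain ⟨p, hp⟩ := Finset.card_pos.mp (Nat.pos_of_ne_zero h)
    simp only [Finset.mem_filter, Finset.mem_univ, true_and] at hp
    have hall : ∀ q : Fin m, 2 * n - 1 - x ≤ (c q ρ.rev).val := by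
      intro q
      have hm : 0 < m := lt_of_le_of_lt (Nat.zero_le _) p.2
      have h1 := hc.mono ρ (p := ⟨0, hm⟩) (q := p) (Nat.zero_le _)
      have h2 := hc.mono ρ.rev (p := ⟨0, hm⟩) (q := q) (Nat.zero_le _)
      have h3 := hc.rat ⟨0, hm⟩ ρ
      omega
    unfold sqB
    rw [Finset.filter_true_of_mem (fun q _ => hall q)]
    simp

lemma sq_A_iff (c : Fin m → Fin n → Fin (2 * n)) (hc : SqStd c) (ρ : Fin n) (x : ℕ)
    (p : Fin m) : (c p ρ).val ≤ x ↔ p.val < sqA c ρ x := by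
  constructor
  · intro h
    have : Finset.Iic p ⊆ Finset.univ.filter fun p => (c p ρ).val ≤ x := by
      intro q hq
      simp only [Finset.mem_filter, Finset.mem_univ, true_and]
      exact (hc.mono ρ (Finset.mem_Iic.mp hq)).trans h
    have := Finset.card_le_card this
    rw [Fin.card_Iic] at this
    exact this
  · intro h
    by_contra hcon
    have : (Finset.univ.filter fun p => (c p ρ).val ≤ x) ⊆ Finset.Iio p := by
      intro q hq
      simp only [Finset.mem_filter, Finset.mem_univ, true_and] at hq
      rw [Finset.mem_Iio]
      by_contra hpq
      exact hcon ((hc.mono ρ (not_lt.mp hpq)).trans hq)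
    have := Finset.card_le_card this
    rw [Fin.card_Iio] at this
    unfold sqA at h
    omega

lemma sq_A_B (c : Fin m → Fin n → Fin (2 * n)) (ρ : Fin n) (x : ℕ) (hx : x + 2 ≤ 2 * n) :
    sqA c ρ x + sqB c ρ (2 * n - 2 - x) = m := by
  have h := Finset.card_filter_add_card_filter_not (s := (Finset.univ : Finset (Fin m)))
    (fun p => (c p ρ).val ≤ x)
  rw [Finset.card_univ, Fintype.card_fin] at h
  refine Eq.trans ?_ h
  unfold sqA sqB
  congr 2
  ext p
  simp only [Finset.mem_filter, Finset.mem_univ, true_and]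
  omega

lemma sq_inj (c c' : Fin m → Fin n → Fin (2 * n)) (hc : SqStd c) (hc' : SqStd c')
    (h : sqExpT c = sqExpT c') : c = c' := by
  have hAB : ∀ ρ x, x < n → sqA c ρ x = sqA c' ρ x ∧ sqB c ρ.rev x = sqB c' ρ.rev x := by
    intro ρ x hx
    have h1 := sq_count c ρ x hx
    rw [h, sq_count c' ρ x hx] at h1
    have h2 := sq_AB c hc ρ x
    have h3 := sq_AB c' hc' ρ x
    have h4 := sqB_le c ρ.rev x
    have h5 := sqB_le c' ρ.rev x
    omega
  have hA : ∀ ρ x, x + 2 ≤ 2 * n → sqA c ρ x = sqA c' ρ x := by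
    intro ρ x hx
    by_cases hxn : x < n
    · exact (hAB ρ x hxn).1
    · have h1 := sq_A_B c ρ x hx
      have h2 := sq_A_B c' ρ x hx
      have h3 := (hAB ρ.rev (2 * n - 2 - x) (by omega)).2
      rw [Fin.rev_rev] at h3
      omega
  have key : ∀ p ρ x, (c p ρ).val ≤ x ↔ (c' p ρ).val ≤ x := by
    intro p ρ x
    by_cases hx : x + 2 ≤ 2 * n
    · rw [sq_A_iff c hc, sq_A_iff c' hc', hA ρ x hx]
    · have h1 := (c p ρ).2
      have h2 := (c' p ρ).2
      constructor <;> intro <;> omega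
  funext p ρ
  apply Fin.ext
  exact le_antisymm ((key p ρ _).mpr le_rfl) ((key p ρ _).mp le_rfl)
end Inj

section Indep
variable {n m : ℕ} {K : Type*} [Field K]

/-- The standard square-zero matrix. -/
def sqN (K : Type*) [Field K] (n : ℕ) : Matrix (Fin n) (Fin n) K :=
  Matrix.of fun u v => if u.val < n / 2 ∧ v = u.rev then 1 else 0

lemma sqN_mul (H : Matrix (Fin n) (Fin n) K) (u x : Fin n) :
    (sqN K n * H) u x = if u.val < n / 2 then H u.rev x else 0 := by
  simp only [Matrix.mul_apply, sqN, Matrix.of_apply]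
  by_cases h : u.val < n / 2 <;> simp [h]

lemma sqN_sq : sqN K n * sqN K n = 0 := by
  ext u x
  rw [sqN_mul]
  split_ifs with h
  · simp only [sqN, Matrix.of_apply, Matrix.zero_apply]
    rw [if_neg]
    rintro ⟨h1, _⟩
    rw [Fin.val_rev] at h1
    omega
  · rfl

lemma sq_conj (H : Matrix (Fin n) (Fin n) K) (hH : IsUnit H.det) (c : Fin n → Fin (2 * n)) :
    H.det * sqD (H⁻¹ * sqN K n * H) c = Matrix.det (Matrix.of fun j u => sqZ H u (c j)) := by
  unfold sqD
  rw [← sq_det_mulVec]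
  refine congrArg (fun f => Matrix.det (Matrix.of f)) (funext fun k => funext fun u => ?_)
  by_cases hx : (c k).val < n
  · have h1 : H * (H⁻¹ * sqN K n * H) = sqN K n * H := by
      rw [← Matrix.mul_assoc, ← Matrix.mul_assoc, Matrix.mul_nonsing_inv _ hH, Matrix.one_mul]
    have h2 := congrFun (congrFun h1 u) ⟨(c k).val, hx⟩
    rw [sqN_mul] at h2
    simp only [sqZ, hx, dif_pos]
    rw [← h2]
    simp [sqY, hx, Matrix.mulVec, dotProduct, Matrix.mul_apply]
  · simp only [sqZ, sqY, hx, dif_neg, not_false_eq_true]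
    rw [Matrix.mulVec_single_one]
    rfl

lemma sq_conj_sq (H : Matrix (Fin n) (Fin n) K) (hH : IsUnit H.det) :
    (H⁻¹ * sqN K n * H) ^ 2 = 0 := by
  have : (H⁻¹ * sqN K n * H) ^ 2 = H⁻¹ * (sqN K n * (H * H⁻¹) * sqN K n) * H := by
    simp only [pow_two, Matrix.mul_assoc]
  rw [this, Matrix.mul_nonsing_inv _ hH, Matrix.mul_one, sqN_sq]
  simp

lemma sq_indep [Infinite K] [Fintype {T : Fin m → Fin n → Fin (2 * n) // SqStd T}]
    (a : {T : Fin m → Fin n → Fin (2 * n) // SqStd T} → K)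
    (h : ∀ M : Matrix (Fin n) (Fin n) K, M ^ 2 = 0 → ∑ T, a T * sqProd M T.1 = 0) :
    ∀ T, a T = 0 := by
  let P : {T : Fin m → Fin n → Fin (2 * n) // SqStd T} → MvPolynomial (Fin n × Fin n) K :=
    fun T => ∏ p, Matrix.det (Matrix.of fun j u => sqZ (sqH K n) u (T.1 p j))
  refine sqLead_indep sqW P (fun T => sqExpT T.1) ?_ ?_ a ?_
  · intro T
    exact sqLead_prod sqW _ _ _ fun p _ => sq_det_lead (T.1 p) (T.2.row p) (T.2.rat p)
  · intro T T' hT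
    exact Subtype.ext (sq_inj _ _ T.2 T'.2 hT)
  · have hdet : (sqH K n).det ≠ 0 := by
      exact Matrix.det_mvPolynomialX_ne_zero (Fin n) K
    refine (mul_eq_zero.mp (?_ : (sqH K n).det * _ = 0)).resolve_left hdet
    apply MvPolynomial.funext
    intro v
    set H : Matrix (Fin n) (Fin n) K := Matrix.of fun i j => v (i, j) with hHdef
    have e1 : MvPolynomial.eval v (sqH K n).det = H.det := by
      rw [RingHom.map_det]
      congr 1
      ext i j
      simp [sqH, hHdef]
    have e2 : ∀ u x, MvPolynomial.eval v (sqZ (sqH K n) u x) = sqZ H u x := by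
      intro u x
      unfold sqZ
      split_ifs <;> simp [sqH, hHdef]
    have e3 : ∀ T, MvPolynomial.eval v (P T) =
        ∏ p, Matrix.det (Matrix.of fun j u => sqZ H u (T.1 p j)) := by
      intro T
      simp only [P, map_prod]
      refine Finset.prod_congr rfl fun p _ => ?_
      rw [RingHom.map_det]
      congr 1
      ext i j
      simp [e2]
    rw [map_mul, map_zero, e1, map_sum]
    simp only [MvPolynomial.smul_eval, e3]
    by_cases hz : H.det = 0
    · rw [hz, zero_mul]
    · have hu : IsUnit H.det := isUnit_iff_ne_zero.mpr hz
      have := h _ (sq_conj_sq H hu)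
      simp only [← sq_conj H hu, Finset.prod_mul_distrib, Finset.prod_const, Finset.card_univ,
        Fintype.card_fin]
      unfold sqProd at this
      have e4 : ∀ T : {T : Fin m → Fin n → Fin (2 * n) // SqStd T},
          a T * (H.det ^ m * ∏ p, sqD (H⁻¹ * sqN K n * H) (T.1 p)) =
          H.det ^ m * (a T * ∏ p, sqD (H⁻¹ * sqN K n * H) (T.1 p)) := fun T => by ring
      simp only [e4]
      rw [← Finset.mul_sum, this, mul_zero, mul_zero]
end Indep

section Final
variable {n m : ℕ}

lemma sqProd_map {R S : Type*} [CommRing R] [CommRing S] (g : R →+* S)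
    (Φ : Matrix (Fin n) (Fin n) R) (c : Fin m → Fin n → Fin (2 * n)) :
    g (sqProd Φ c) = sqProd (Φ.map g) c := by
  unfold sqProd
  rw [map_prod]
  refine Finset.prod_congr rfl fun p _ => ?_
  unfold sqD
  rw [RingHom.map_det]
  congr 1
  ext i j
  by_cases h : (c p i).val < n
  · simp [sqY, h]
  · simp [sqY, h, Pi.single_apply, apply_ite g]

lemma sq_det_map {R S : Type*} [CommRing R] [CommRing S] (g : R →+* S)
    (Φ : Matrix (Fin n) (Fin n) R) :
    Polynomial.mapRingHom g
      (Matrix.det (1 + (Polynomial.X : Polynomial R) • Φ.map Polynomial.C)) =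
    Matrix.det (1 + (Polynomial.X : Polynomial S) • (Φ.map g).map Polynomial.C) := by
  rw [RingHom.map_det]
  congr 1
  ext1 i j
  by_cases h : i = j <;> simp [h]

/-- The hard inclusion. -/
lemma sq_main (K : Type*) [Field K] [Infinite K] (n : ℕ)
    (Φ : Matrix (Fin n) (Fin n) (MvPolynomial (Fin n × Fin n) K))
    (hΦ : Φ = Matrix.of fun i j => MvPolynomial.X (i, j))
    (I : Ideal (MvPolynomial (Fin n × Fin n) K))
    (h2 : ∀ i j, (Φ * Φ) i j ∈ I)
    (hT : ∀ k, 1 ≤ k → (Matrix.det (1 + (Polynomial.X :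
      Polynomial (MvPolynomial (Fin n × Fin n) K)) • Φ.map Polynomial.C)).coeff k ∈ I)
    (hI : ∀ f ∈ I, ∀ M : Matrix (Fin n) (Fin n) K, M ^ 2 = 0 →
      MvPolynomial.eval (fun p => M p.1 p.2) f = 0)
    (f : MvPolynomial (Fin n × Fin n) K)
    (hf : ∀ M : Matrix (Fin n) (Fin n) K, M ^ 2 = 0 →
      MvPolynomial.eval (fun p => M p.1 p.2) f = 0) : f ∈ I := by
  classical
  set g := Ideal.Quotient.mk I with hg
  have h2' : Φ.map g * Φ.map g = 0 := by
    rw [← Matrix.map_mul]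
    ext i j
    simpa [hg] using Ideal.Quotient.eq_zero_iff_mem.mpr (h2 i j)
  have hd' : Matrix.det (1 + (Polynomial.X : Polynomial (MvPolynomial (Fin n × Fin n) K ⧸ I)) •
      (Φ.map g).map Polynomial.C) = 1 := by
    rw [← sq_det_map]
    ext k
    rw [Polynomial.coe_mapRingHom, Polynomial.coeff_map]
    rcases Nat.eq_zero_or_pos k with rfl | hk
    · rw [Matrix.coeff_det_one_add_X_smul_eq_sum_minors]
      simp
    · rw [Polynomial.coeff_one, if_neg (by omega)]
      exact Ideal.Quotient.eq_zero_iff_mem.mpr (hT k hk)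
  obtain ⟨m, hm⟩ := sq_gen K f
  rw [← hΦ] at hm
  let W : Submodule K (MvPolynomial (Fin n × Fin n) K ⧸ I) :=
    Submodule.span K (Set.range fun T : {T : Fin m → Fin n → Fin (2 * n) // SqStd T} =>
      sqProd (Φ.map g) T.1)
  have hmem : g f ∈ W := by
    have hle : Submodule.span K (Set.range fun c : Fin m → Fin n → Fin (2 * n) => sqProd Φ c) ≤
        W.comap (Ideal.Quotient.mkₐ K I).toLinearMap := by
      rw [Submodule.span_le]
      rintro _ ⟨c, rfl⟩
      change g (sqProd Φ c) ∈ W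
      rw [sqProd_map]
      exact sq_straight K (Φ.map g) h2' hd' W
        (fun T hT => Submodule.subset_span ⟨⟨T, hT⟩, rfl⟩) _ _ c rfl rfl
    exact hle hm
  obtain ⟨a, ha⟩ := (Submodule.mem_span_range_iff_exists_fun K).mp hmem
  have hsub : f - ∑ T, a T • sqProd Φ T.1 ∈ I := by
    rw [← Ideal.Quotient.eq_zero_iff_mem, map_sub, sub_eq_zero, map_sum]
    change g f = _
    rw [← ha]
    refine Finset.sum_congr rfl fun T _ => ?_
    rw [← sqProd_map]
    exact (map_smul (Ideal.Quotient.mkₐ K I) (a T) (sqProd Φ T.1)).symm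
  have hz : ∀ T, a T = 0 := by
    refine sq_indep a fun M hM => ?_
    have h1 := hI _ hsub M hM
    rw [map_sub, hf M hM, zero_sub, neg_eq_zero, map_sum] at h1
    rw [← h1]
    refine Finset.sum_congr rfl fun T _ => ?_
    rw [MvPolynomial.smul_eval, sqProd_map]
    congr 2
    ext i j
    simp [hΦ]
  simpa [hz] using hsub

lemma sq_coeff_zero {K : Type*} [Field K] (M : Matrix (Fin n) (Fin n) K) (hM : M ^ 2 = 0)
    (k : ℕ) (hk : 1 ≤ k) :
    (Matrix.det (1 + (Polynomial.X : Polynomial K) • M.map Polynomial.C)).coeff k = 0 := by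
  have h : (1 + (Polynomial.X : Polynomial K) • M.map Polynomial.C) *
      (1 - (Polynomial.X : Polynomial K) • M.map Polynomial.C) = 1 := by
    have hΨ2 : M.map (Polynomial.C : K →+* Polynomial K) * M.map Polynomial.C = 0 := by
      rw [← Matrix.map_mul, ← pow_two, hM]; simp
    simp [add_mul, mul_sub, hΨ2]
  have hu : IsUnit (Matrix.det (1 + (Polynomial.X : Polynomial K) • M.map Polynomial.C)) := by
    refine IsUnit.of_mul_eq_one (Matrix.det (1 - (Polynomial.X : Polynomial K) • M.map Polynomial.C)) ?_
    rw [← Matrix.det_mul, h, Matrix.det_one]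
  obtain ⟨r, _, hr⟩ := Polynomial.isUnit_iff.mp hu
  rw [← hr, Polynomial.coeff_C, if_neg (by omega)]
end Final

theorem ideal_of_square_zero_matrices (K : Type*) [Field K] [IsAlgClosed K]
    (n : ℕ) (hn : 1 ≤ n) :
    {f : MvPolynomial (Fin n × Fin n) K |
        ∀ M : Matrix (Fin n) (Fin n) K, M ^ 2 = 0 →
          eval (fun p => M p.1 p.2) f = 0}
      = ↑(Ideal.span
          ({f | ∃ i, 1 ≤ i ∧ i ≤ n ∧ f = principalMinorSum K n i} ∪
           {f | ∃ k l, f = (genericMatrix K n ^ 2) k l})) := by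
  have hcoef : ∀ k, (Matrix.det (1 + (Polynomial.X :
      Polynomial (MvPolynomial (Fin n × Fin n) K)) •
        (genericMatrix K n).map Polynomial.C)).coeff k = principalMinorSum K n k := by
    intro k
    rw [Matrix.coeff_det_one_add_X_smul_eq_sum_minors]
    rfl
  have hgen : ∀ M : Matrix (Fin n) (Fin n) K,
      (genericMatrix K n).map (MvPolynomial.eval (fun p => M p.1 p.2)) = M := by
    intro M
    ext i j
    simp [genericMatrix]
  have hI : ∀ f ∈ Ideal.span
      ({f | ∃ i, 1 ≤ i ∧ i ≤ n ∧ f = principalMinorSum K n i} ∪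
        {f | ∃ k l, f = (genericMatrix K n ^ 2) k l}),
      ∀ M : Matrix (Fin n) (Fin n) K, M ^ 2 = 0 →
        MvPolynomial.eval (fun p => M p.1 p.2) f = 0 := by
    intro f hf M hM
    have hle : Ideal.span
      ({f | ∃ i, 1 ≤ i ∧ i ≤ n ∧ f = principalMinorSum K n i} ∪
        {f | ∃ k l, f = (genericMatrix K n ^ 2) k l}) ≤
        RingHom.ker (MvPolynomial.eval (fun p : Fin n × Fin n => M p.1 p.2)) := by
      rw [Ideal.span_le]
      rintro g (⟨i, hi, _, rfl⟩ | ⟨k, l, rfl⟩)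
      · rw [SetLike.mem_coe, RingHom.mem_ker, ← hcoef, ← sq_coeff_zero M hM i hi,
          ← Polynomial.coeff_map, ← Polynomial.coe_mapRingHom, sq_det_map, hgen]
      · rw [SetLike.mem_coe, RingHom.mem_ker]
        have h1 : ((genericMatrix K n ^ 2).map
            (MvPolynomial.eval (fun p : Fin n × Fin n => M p.1 p.2))) k l = 0 := by
          rw [pow_two, Matrix.map_mul, hgen, ← pow_two, hM]
          rfl
        exact h1
    exact hle hf
  haveI : Infinite K := IsAlgClosed.instInfinite
  apply Set.Subset.antisymm
  · intro f hf
    refine sq_main K n (genericMatrix K n) rfl _ ?_ ?_ hI f hf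
    · intro i j
      refine Ideal.subset_span (Or.inr ⟨i, j, ?_⟩)
      rw [pow_two]
    · intro k hk
      rw [hcoef]
      by_cases hkn : k ≤ n
      · exact Ideal.subset_span (Or.inl ⟨k, hk, hkn, rfl⟩)
      · have : principalMinorSum K n k = 0 := by
          unfold principalMinorSum
          rw [Finset.powersetCard_eq_empty.mpr (by simpa using not_le.mp hkn), Finset.sum_empty]
        rw [this]
        exact Ideal.zero_mem _
  · intro f hf
    exact hI f hf
end

section
/- Let K be a field, n ≥ 1, and let r, p be integers with 1 ≤ r ≤ p ≤ n. For any functions a, b : Fin (p−r) → Fin n, the polynomial Rel(r,p) := Σ_{i} M(a ⧺ i ; b ⧺ i), where the sum is over all strictly increasing functions i : Fin r → Fin n and a ⧺ i denotes the concatenated row-index tuple (similarly b ⧺ i for columns), lies in the ideal of A generated by the invariants T_1, T_2, …, T_n together with the n² entries of the matrix Φ². -/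
open MvPolynomial

/-- The minor `M(a ; b)` of the generic `n × n` matrix. -/
noncomputable def genericMinor (K : Type*) [CommRing K] {n r : ℕ}
    (a b : Fin r → Fin n) : MvPolynomial (Fin n × Fin n) K :=
  Matrix.det (Matrix.of fun s t => (X (a s, b t) : MvPolynomial (Fin n × Fin n) K))

/-- Expansion of a determinant in which the unit vector is added to some rows. -/
lemma det_expand {m S : Type*} [Fintype m] [DecidableEq m] [CommRing S] (M : Matrix m m S)
    (U : Finset m) (t : S) :
    Matrix.det (Matrix.of fun i j => if i ∈ U then t * M i j + (1 : Matrix m m S) i j else M i j)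
      = ∑ s ∈ U.powerset, t ^ s.card *
        (M.submatrix (fun x : {x // x ∉ U ∨ x ∈ s} => (x : m))
          (fun x : {x // x ∉ U ∨ x ∈ s} => (x : m))).det := by
  let v : m → m → S := fun i => t • M i
  let w : m → m → S := fun i => if i ∈ U then (1 : Matrix m m S) i else M i
  have h := (Matrix.detRowAlternating (n := m) (R := S)).toMultilinearMap.map_piecewise_add v w U
  have e : (Matrix.of fun i j => if i ∈ U then t * M i j + (1 : Matrix m m S) i j else M i j)
      = U.piecewise (v + w) w := by
    ext i j
    by_cases hi : i ∈ U <;> simp [hi, v, w]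
  rw [e]
  refine Eq.trans h (Finset.sum_congr rfl fun s hs => ?_)
  have hsU := Finset.mem_powerset.1 hs
  change Matrix.det (s.piecewise v w : Matrix m m S) = _
  let N : Matrix m m S := fun i => if i ∈ U ∧ i ∉ s then (1 : Matrix m m S) i else M i
  have e2 : (s.piecewise v w : Matrix m m S)
      = Matrix.of fun i j => (if i ∈ s then t else 1) * N i j := by
    ext i j
    by_cases hi : i ∈ s
    · simp [hi, v, N]
    · by_cases hU : i ∈ U <;> simp [hi, hU, w, N]
  rw [e2, Matrix.det_mul_column]
  congr 1
  · simp [Finset.prod_ite]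
  · rw [Matrix.twoBlockTriangular_det N (fun x => x ∉ U ∨ x ∈ s)]
    · have e3 : N.toSquareBlockProp (fun x => ¬ (x ∉ U ∨ x ∈ s)) = 1 := by
        ext i j
        have hi := i.2
        push Not at hi
        change N i j = _
        simp only [N, if_pos hi, Matrix.one_apply, Subtype.ext_iff]
      rw [e3, Matrix.det_one, mul_one]
      congr 1
      ext i j
      have hi : ¬ ((i : m) ∈ U ∧ (i : m) ∉ s) := by have := i.2; tauto
      change N i j = M i j
      simp only [N, if_neg hi]
    · intro i hi j hj
      push Not at hi
      have : i ≠ j := by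
        rintro rfl
        tauto
      simp [N, hi, Matrix.one_apply, this]

/-- The case of `1 + t M`. -/
lemma det_one_add_expand {m S : Type*} [Fintype m] [DecidableEq m] [CommRing S] (M : Matrix m m S)
    (t : S) :
    Matrix.det (t • M + 1)
      = ∑ s : Finset m, t ^ s.card *
        (M.submatrix (fun x : {x // x ∈ s} => (x : m)) (fun x : {x // x ∈ s} => (x : m))).det := by
  have h := det_expand M Finset.univ t
  have e : (Matrix.of fun i j => if i ∈ Finset.univ then t * M i j + (1 : Matrix m m S) i j
      else M i j) = t • M + 1 := by
    ext i j; simp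
  rw [e] at h
  rw [h, Finset.powerset_univ]
  refine Finset.sum_congr rfl fun s _ => ?_
  congr 1
  rw [← Matrix.det_submatrix_equiv_self
    (Equiv.subtypeEquivRight (p := fun x => x ∈ s) (q := fun x => x ∉ Finset.univ ∨ x ∈ s)
      (by simp))]
  rfl

/-- The bordered case, for minors with repeated rows and columns. -/
lemma det_border_expand {n d : ℕ} {S : Type*} [CommRing S] (M : Matrix (Fin n) (Fin n) S)
    (a b : Fin d → Fin n) (t : S) :
    Matrix.det (Matrix.fromBlocks (M.submatrix a b) (M.submatrix a id)
      (t • M.submatrix id b) (t • M + 1))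
      = ∑ s : Finset (Fin n), t ^ s.card *
        (M.submatrix (Sum.elim a (fun x : {x // x ∈ s} => (x : Fin n)))
          (Sum.elim b (fun x : {x // x ∈ s} => (x : Fin n)))).det := by
  have h := det_expand (M.submatrix (Sum.elim a id) (Sum.elim b id))
    (Finset.univ.map Function.Embedding.inr) t
  have e : (Matrix.of fun i j => if i ∈ (Finset.univ.map Function.Embedding.inr :
      Finset (Fin d ⊕ Fin n)) then t * (M.submatrix (Sum.elim a id) (Sum.elim b id)) i j
        + (1 : Matrix (Fin d ⊕ Fin n) (Fin d ⊕ Fin n) S) i j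
      else (M.submatrix (Sum.elim a id) (Sum.elim b id)) i j)
      = Matrix.fromBlocks (M.submatrix a b) (M.submatrix a id)
      (t • M.submatrix id b) (t • M + 1) := by
    ext i j
    rcases i with i | i <;> rcases j with j | j <;> simp [Matrix.one_apply]
  rw [e] at h
  rw [h]
  symm
  refine Finset.sum_bij (fun s _ => s.map Function.Embedding.inr) ?_ ?_ ?_ ?_
  · intro s _
    simp
  · intro s _ s' _ hh
    exact Finset.map_injective _ hh
  · intro s hs
    rw [Finset.mem_powerset, Finset.subset_map_iff] at hs
    obtain ⟨u, _, hu⟩ := hs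
    exact ⟨u, Finset.mem_univ _, hu.symm⟩
  · intro s _
    rw [Finset.card_map]
    congr 1
    let f : Fin d ⊕ {x // x ∈ s} → {x : Fin d ⊕ Fin n //
        x ∉ (Finset.univ.map Function.Embedding.inr : Finset (Fin d ⊕ Fin n)) ∨
          x ∈ s.map Function.Embedding.inr} :=
      Sum.elim (fun i => ⟨Sum.inl i, by simp⟩) (fun i => ⟨Sum.inr i, by simp⟩)
    have hf : Function.Bijective f := by
      constructor
      · rintro (i | i) (j | j) hij
        · exact congrArg Sum.inl (Sum.inl.inj (congrArg Subtype.val hij))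
        · exact absurd (congrArg Subtype.val hij) Sum.inl_ne_inr
        · exact absurd (congrArg Subtype.val hij) Sum.inr_ne_inl
        · exact congrArg Sum.inr (Subtype.ext (Sum.inr.inj (congrArg Subtype.val hij)))
      · rintro ⟨i | i, hi⟩
        · exact ⟨Sum.inl i, rfl⟩
        · have : i ∈ s := by simpa using hi
          exact ⟨Sum.inr ⟨i, this⟩, rfl⟩
    rw [← Matrix.det_submatrix_equiv_self (Equiv.ofBijective f hf)]
    congr 1
    ext i j
    rcases i with i | i <;> rcases j with j | j <;> rfl

/-- Evaluation of the bordered determinant when `M ^ 2 = 0`. -/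
lemma det_border_eq {n d : ℕ} {S : Type*} [CommRing S] (M : Matrix (Fin n) (Fin n) S)
    (hM : M * M = 0) (a b : Fin d → Fin n) (t : S) :
    Matrix.det (Matrix.fromBlocks (M.submatrix a b) (M.submatrix a id)
      (t • M.submatrix id b) (t • M + 1)) = (M.submatrix a b).det * (t • M + 1).det := by
  have hz : ∀ {k l : Type} (f : k → Fin n) (g : l → Fin n),
      M.submatrix f id * M.submatrix id g = 0 := by
    intro k l f g
    rw [← Matrix.submatrix_mul _ _ _ _ _ Function.bijective_id, hM]; rfl
  have e : Matrix.fromBlocks (M.submatrix a b) (M.submatrix a id)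
      (t • M.submatrix id b) (t • M + 1) =
      Matrix.fromBlocks (M.submatrix a b) (M.submatrix a id) 0 (t • M + 1) *
      Matrix.fromBlocks 1 0 (t • M.submatrix id b) 1 := by
    have h1 := hz a b
    have h2 : M * M.submatrix id b = 0 := hz id b
    rw [Matrix.fromBlocks_multiply]
    congr 1 <;> simp [Matrix.add_mul, h1, h2]
  rw [e, Matrix.det_mul, Matrix.det_fromBlocks_zero₂₁, Matrix.det_fromBlocks_zero₁₂]
  simp

/-- If `M ^ 2 = 0` and all the invariants vanish, the relations vanish. -/
lemma rel_eq_zero {n d : ℕ} {R : Type*} [CommRing R] (M : Matrix (Fin n) (Fin n) R)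
    (hM : M * M = 0)
    (hT : ∀ i, 1 ≤ i → ∑ I ∈ (Finset.univ : Finset (Fin n)).powersetCard i,
      (M.submatrix (fun x : {x // x ∈ I} => (x : Fin n))
        (fun x : {x // x ∈ I} => (x : Fin n))).det = 0)
    (a b : Fin d → Fin n) (r : ℕ) (hr : 1 ≤ r) :
    ∑ s ∈ (Finset.univ : Finset (Fin n)).powersetCard r,
      (M.submatrix (Sum.elim a (fun x : {x // x ∈ s} => (x : Fin n)))
          (Sum.elim b (fun x : {x // x ∈ s} => (x : Fin n)))).det = 0 := by
  let N : Matrix (Fin n) (Fin n) (Polynomial R) := M.map Polynomial.C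
  have hC : ∀ {k : Type} [Fintype k] [DecidableEq k] (f g : k → Fin n),
      (N.submatrix f g).det = Polynomial.C (M.submatrix f g).det := by
    intro k _ _ f g
    rw [RingHom.map_det]; rfl
  have hN : N * N = 0 := by
    rw [← Matrix.map_mul, hM]; simp
  have key := (det_border_expand N a b Polynomial.X).symm.trans
    (det_border_eq N hN a b Polynomial.X)
  have h1 : ((Polynomial.X : Polynomial R) • N + 1).det = 1 := by
    rw [det_one_add_expand]
    simp_rw [hC]
    ext k
    rw [Polynomial.finsetSum_coeff]
    simp_rw [mul_comm (Polynomial.X ^ _), Polynomial.coeff_C_mul_X_pow]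
    rcases Nat.eq_zero_or_pos k with rfl | hk
    · simp only [eq_comm (a := 0), Finset.card_eq_zero]
      rw [Finset.sum_ite_eq']
      simp
    · rw [← Finset.sum_filter, Polynomial.coeff_one, if_neg (by omega)]
      rw [← hT k hk]
      refine Finset.sum_congr ?_ fun _ _ => rfl
      ext s; simp [Finset.mem_powersetCard, eq_comm]
  rw [h1, mul_one] at key
  simp_rw [hC] at key
  have := congrArg (fun f => Polynomial.coeff f r) key
  simp only [Polynomial.finsetSum_coeff, mul_comm (Polynomial.X ^ _),
    Polynomial.coeff_C_mul_X_pow] at this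
  rw [Polynomial.coeff_C, if_neg (by omega), ← Finset.sum_filter] at this
  rw [← this]
  refine Finset.sum_congr ?_ fun _ _ => rfl
  ext s; simp [Finset.mem_powersetCard, eq_comm]

open scoped Classical in
/-- Passing from strictly increasing tuples to subsets. -/
lemma rel_eq_sum {n d r : ℕ} {S : Type*} [CommRing S] (M : Matrix (Fin n) (Fin n) S)
    (a b : Fin d → Fin n) :
    ∑ i ∈ Finset.univ.filter (fun i : Fin r → Fin n => StrictMono i),
      (M.submatrix (Fin.append a i) (Fin.append b i)).det =
    ∑ s ∈ (Finset.univ : Finset (Fin n)).powersetCard r,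
      (M.submatrix (Sum.elim a (fun x : {x // x ∈ s} => (x : Fin n)))
          (Sum.elim b (fun x : {x // x ∈ s} => (x : Fin n)))).det := by
  refine Finset.sum_bij (fun i _ => Finset.univ.image i) ?_ ?_ ?_ ?_
  · intro i hi
    have hi : StrictMono i := by simpa using hi
    simp [Finset.mem_powersetCard, Finset.card_image_of_injective _ hi.injective]
  · intro i hi j hj hij
    have hi : StrictMono i := by simpa using hi
    have hj : StrictMono j := by simpa using hj
    refine (StrictMono.range_inj hi hj).1 ?_
    have := congrArg (fun s : Finset (Fin n) => (s : Set (Fin n))) hij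
    simpa using this
  · intro s hs
    have hs : s.card = r := by simpa [Finset.mem_powersetCard] using hs
    refine ⟨s.orderEmbOfFin hs, by simpa using (s.orderEmbOfFin hs).strictMono, ?_⟩
    simp
  · intro i hi
    have hi : StrictMono i := by simpa using hi
    let f : Fin r → {x // x ∈ Finset.univ.image i} := fun k => ⟨i k, by simp⟩
    have hf : Function.Bijective f := by
      constructor
      · intro x y hxy
        exact hi.injective (congrArg Subtype.val hxy)
      · rintro ⟨x, hx⟩
        obtain ⟨k, _, rfl⟩ := Finset.mem_image.1 hx
        exact ⟨k, rfl⟩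
    rw [← Matrix.det_submatrix_equiv_self finSumFinEquiv,
      ← Matrix.det_submatrix_equiv_self
        (Equiv.sumCongr (Equiv.refl (Fin d)) (Equiv.ofBijective f hf))]
    congr 1
    ext x y
    rcases x with x | x <;> rcases y with y | y <;> simp [f]

open scoped Classical in
theorem rel_mem_ideal_span_invariants_and_square_entries (K : Type*) [Field K]
    (n r p : ℕ) (hn : 1 ≤ n) (hr : 1 ≤ r) (hrp : r ≤ p) (hpn : p ≤ n)
    (a b : Fin (p - r) → Fin n) :
    (∑ i ∈ Finset.univ.filter (fun i : Fin r → Fin n => StrictMono i),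
        genericMinor K (Fin.append a i) (Fin.append b i))
      ∈ Ideal.span
          ({f | ∃ i, 1 ≤ i ∧ i ≤ n ∧ f = principalMinorSum K n i} ∪
           {f | ∃ k l, f = (genericMatrix K n ^ 2) k l}) := by
  set J := Ideal.span
          ({f | ∃ i, 1 ≤ i ∧ i ≤ n ∧ f = principalMinorSum K n i} ∪
           {f | ∃ k l, f = (genericMatrix K n ^ 2) k l}) with hJ
  have h0 := rel_eq_sum (r := r) (genericMatrix K n) a b
  change (∑ i ∈ Finset.univ.filter (fun i : Fin r → Fin n => StrictMono i),
      ((genericMatrix K n).submatrix (Fin.append a i) (Fin.append b i)).det) ∈ J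
  rw [h0, ← Ideal.Quotient.eq_zero_iff_mem, map_sum]
  let M := (genericMatrix K n).map (Ideal.Quotient.mk J)
  have hC : ∀ {k : Type} [Fintype k] [DecidableEq k] (f g : k → Fin n),
      Ideal.Quotient.mk J ((genericMatrix K n).submatrix f g).det = (M.submatrix f g).det := by
    intro k _ _ f g
    rw [RingHom.map_det]; rfl
  simp_rw [hC]
  refine rel_eq_zero M ?_ ?_ a b r hr
  · rw [← Matrix.map_mul, ← pow_two]
    ext k l
    rw [Matrix.map_apply, Matrix.zero_apply, Ideal.Quotient.eq_zero_iff_mem]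
    exact Ideal.subset_span (Or.inr ⟨k, l, rfl⟩)
  · intro i hi
    simp_rw [← hC]
    rw [← map_sum, Ideal.Quotient.eq_zero_iff_mem]
    by_cases hin : i ≤ n
    · exact Ideal.subset_span (Or.inl ⟨i, hi, hin, rfl⟩)
    · rw [Finset.powersetCard_eq_empty.2 (by simp; omega)]
      simp
end

section
/- Let K be a field, n ≥ 1, and set m = ⌊n/2⌋ + 1. Then every m×m minor of the generic matrix Φ lies in the ideal of A generated by the invariants T_1, T_2, …, T_n together with the n² entries of the matrix Φ²; that is, for all functions a, b : Fin m → Fin n, the determinant M(a ; b) belongs to that ideal. -/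
open MvPolynomial

theorem exists_sumEquiv_extending {m n : ℕ} (a : Fin m → Fin n) (ha : Function.Injective a) :
    ∃ e : Fin m ⊕ Fin (n - m) ≃ Fin n, ∀ i, e (Sum.inl i) = a i := by
  classical
  have hcard : Fintype.card (Fin (n - m)) = Fintype.card ((Set.range a)ᶜ : Set (Fin n)) := by
    rw [Fintype.card_compl_set, Set.card_range_of_injective ha]
    simp
  refine ⟨(Equiv.sumCongr (Equiv.ofInjective a ha) (Fintype.equivOfCardEq hcard)).trans
    (Equiv.Set.sumCompl (Set.range a)), fun i => ?_⟩
  simp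

theorem det_submatrix_equiv_equiv {S p q : Type*} [CommRing S] [Fintype p] [DecidableEq p]
    [Fintype q] [DecidableEq q] (M : Matrix q q S) (σ τ : p ≃ q) :
    ∃ c : ℤˣ, (M.submatrix τ σ).det = ((c : ℤ) : S) * M.det := by
  refine ⟨Equiv.Perm.sign (τ.symm.trans σ), ?_⟩
  rw [← Matrix.det_permute', ← Matrix.det_submatrix_equiv_self τ]
  congr 1
  ext i j
  simp

/-- Jacobi's complementary minor identity, in block form. -/
theorem det_toBlocks_mul_det {S p q : Type*} [CommRing S] [Fintype p] [DecidableEq p]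
    [Fintype q] [DecidableEq q] (N M : Matrix (p ⊕ q) (p ⊕ q) S) (h : N * M = 1) :
    N.toBlocks₁₁.det * M.det = M.toBlocks₂₂.det := by
  have key : Matrix.fromBlocks N.toBlocks₁₁ N.toBlocks₁₂ 0 1 * M =
      Matrix.fromBlocks 1 0 M.toBlocks₂₁ M.toBlocks₂₂ := by
    rw [← Matrix.fromBlocks_toBlocks N, ← Matrix.fromBlocks_toBlocks M,
      Matrix.fromBlocks_multiply, ← Matrix.fromBlocks_one, Matrix.fromBlocks_inj] at h
    obtain ⟨h1, h2, -, -⟩ := h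
    conv_lhs => rw [← Matrix.fromBlocks_toBlocks M]
    rw [Matrix.fromBlocks_multiply, h1, h2]
    simp
  have := congrArg Matrix.det key
  simpa [Matrix.det_mul, Matrix.det_fromBlocks_zero₂₁, Matrix.det_fromBlocks_zero₁₂] using this

open Polynomial in
theorem minor_eq_zero_of_sq_eq_zero {R : Type*} [CommRing R] {n m : ℕ}
    (F : Matrix (Fin n) (Fin n) R) (hsq : F * F = 0)
    (hdet : (1 + (Polynomial.X : R[X]) • F.map Polynomial.C).det = 1)
    (hm : n - m < m) (a b : Fin m → Fin n) : (F.submatrix a b).det = 0 := by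
  by_cases ha : Function.Injective a
  swap
  · obtain ⟨i, j, hij, hne⟩ : ∃ i j, a i = a j ∧ i ≠ j := by
      simpa [Function.Injective] using ha
    exact Matrix.det_zero_of_row_eq hne (by ext k; simp [hij])
  by_cases hb : Function.Injective b
  swap
  · obtain ⟨i, j, hij, hne⟩ : ∃ i j, b i = b j ∧ i ≠ j := by
      simpa [Function.Injective] using hb
    exact Matrix.det_zero_of_column_eq hne (by intro k; simp [hij])
  obtain ⟨σ, hσ⟩ := exists_sumEquiv_extending a ha
  obtain ⟨τ, hτ⟩ := exists_sumEquiv_extending b hb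
  set M : Matrix (Fin n) (Fin n) R[X] := 1 + (Polynomial.X : R[X]) • F.map Polynomial.C with hM
  set N : Matrix (Fin n) (Fin n) R[X] := 1 - (Polynomial.X : R[X]) • F.map Polynomial.C with hN
  have hFF : F.map Polynomial.C * F.map Polynomial.C = 0 := by
    rw [← Matrix.map_mul, hsq]; simp
  have hNM : N * M = 1 := by
    rw [hN, hM, sub_mul, mul_add, mul_add, smul_mul_smul_comm, hFF]
    simp
  have hNM' : N.submatrix σ τ * M.submatrix τ σ = 1 := by
    rw [Matrix.submatrix_mul_equiv, hNM, Matrix.submatrix_one_equiv]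
  have hJ := det_toBlocks_mul_det _ _ hNM'
  obtain ⟨c, hc⟩ := det_submatrix_equiv_equiv M σ τ
  rw [hc, hdet, mul_one] at hJ
  have h1 : (N.submatrix σ τ).toBlocks₁₁ =
      (Polynomial.X : R[X]) • (-(F.submatrix a b)).map Polynomial.C
        + ((1 : Matrix (Fin n) (Fin n) R).submatrix a b).map Polynomial.C := by
    ext1 i j
    by_cases hij : a i = b j <;>
      simp [hN, Matrix.toBlocks₁₁, hσ, hτ, Matrix.one_apply, hij] <;> ring
  have h2 : (M.submatrix τ σ).toBlocks₂₂ =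
      (Polynomial.X : R[X]) •
          (F.submatrix (fun i => τ (Sum.inr i)) (fun i => σ (Sum.inr i))).map Polynomial.C
        + ((1 : Matrix (Fin n) (Fin n) R).submatrix (fun i => τ (Sum.inr i))
          (fun i => σ (Sum.inr i))).map Polynomial.C := by
    ext1 i j
    by_cases hij : τ (Sum.inr i) = σ (Sum.inr j) <;>
      simp [hM, Matrix.toBlocks₂₂, Matrix.one_apply, hij] <;> ring
  rw [h1, h2] at hJ
  have hcoef := congrArg (fun f => Polynomial.coeff f m) hJ
  have hz := Polynomial.natDegree_det_X_add_C_le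
    (F.submatrix (fun i => τ (Sum.inr i)) (fun i => σ (Sum.inr i)))
    ((1 : Matrix (Fin n) (Fin n) R).submatrix (fun i => τ (Sum.inr i)) (fun i => σ (Sum.inr i)))
  have hlead := Polynomial.coeff_det_X_add_C_card (-(F.submatrix a b))
    ((1 : Matrix (Fin n) (Fin n) R).submatrix a b)
  rw [Fintype.card_fin] at hz hlead
  rw [Polynomial.coeff_eq_zero_of_natDegree_lt (lt_of_le_of_lt hz hm),
    Polynomial.coeff_mul_intCast, hlead, Matrix.det_neg] at hcoef
  rcases Int.units_eq_one_or c with rfl | rfl <;>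
    rcases neg_one_pow_eq_or R (Fintype.card (Fin m)) with h | h <;>
    simpa [h] using hcoef

theorem minor_mem_ideal_span_invariants_and_square_entries (K : Type*) [Field K]
    (n : ℕ) (hn : 1 ≤ n) (a b : Fin (n / 2 + 1) → Fin n) :
    genericMinor K a b
      ∈ Ideal.span
          ({f | ∃ i, 1 ≤ i ∧ i ≤ n ∧ f = principalMinorSum K n i} ∪
           {f | ∃ k l, f = (genericMatrix K n ^ 2) k l}) := by
  classical
  set I := Ideal.span
          ({f | ∃ i, 1 ≤ i ∧ i ≤ n ∧ f = principalMinorSum K n i} ∪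
           {f | ∃ k l, f = (genericMatrix K n ^ 2) k l}) with hI
  rw [← Ideal.Quotient.eq_zero_iff_mem]
  set π := Ideal.Quotient.mk I
  set F := (genericMatrix K n).map π with hF
  have hminor : π (genericMinor K a b) = (F.submatrix a b).det := by
    rw [genericMinor, RingHom.map_det]
    rfl
  rw [hminor]
  apply minor_eq_zero_of_sq_eq_zero F
  · ext k l
    have : F * F = (genericMatrix K n ^ 2).map π := by
      rw [hF, ← Matrix.map_mul, pow_two]
    rw [this]
    exact Ideal.Quotient.eq_zero_iff_mem.2 (Ideal.subset_span (Or.inr ⟨k, l, rfl⟩))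
  · ext k
    rw [Matrix.coeff_det_one_add_X_smul_eq_sum_minors]
    have hT : ∑ s ∈ Finset.univ.powersetCard k,
        (F.submatrix (Subtype.val : s → Fin n) (Subtype.val : s → Fin n)).det
        = π (principalMinorSum K n k) := by
      rw [principalMinorSum, map_sum]
      refine Finset.sum_congr rfl fun s _ => ?_
      rw [RingHom.map_det]
      rfl
    rcases Nat.eq_zero_or_pos k with rfl | hk
    · simp
    rw [Polynomial.coeff_one, if_neg (by omega)]
    by_cases hkn : k ≤ n
    · rw [hT]
      exact Ideal.Quotient.eq_zero_iff_mem.2 (Ideal.subset_span (Or.inl ⟨k, hk, hkn, rfl⟩))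
    · rw [Finset.powersetCard_eq_empty.2 (by simpa using hkn), Finset.sum_empty]
  · omega
end

section
/- Let n ≥ 1 be an integer and set m = ⌊n/2⌋ + 1. Then the greatest common divisor of the binomial coefficients C(n − m + r, r) over all integers r with 1 ≤ r ≤ m equals 1. -/
theorem aux_choose (p : ℕ) (hp : p.Prime) (u i : ℕ) :
    Nat.choose (p ^ i * (u + 1) - 1) (p ^ i) ≡ u [MOD p] := by
  induction i with
  | zero => simp; rfl
  | succ i ih =>
    haveI := Fact.mk hp
    have h := Choose.choose_modEq_choose_mod_mul_choose_div_nat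
      (n := p ^ (i + 1) * (u + 1) - 1) (k := p ^ (i + 1)) (p := p)
    have h1 : p ^ (i + 1) % p = 0 := by simp [pow_succ]
    have h2 : p ^ (i + 1) / p = p ^ i := by
      rw [pow_succ]; exact Nat.mul_div_cancel _ hp.pos
    have h3 : (p ^ (i + 1) * (u + 1) - 1) / p = p ^ i * (u + 1) - 1 := by
      have e : p ^ (i + 1) * (u + 1) = p * (p ^ i * (u + 1)) := by ring
      rw [e]
      have hpos : 0 < p ^ i * (u + 1) := Nat.mul_pos (pow_pos hp.pos i) (Nat.succ_pos u)
      obtain ⟨a, ha⟩ : ∃ a, p ^ i * (u + 1) = a + 1 := ⟨_, (Nat.succ_pred_eq_of_pos hpos).symm⟩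
      rw [ha]
      have hp0 := hp.pos
      have e2 : p * (a + 1) - 1 = (p - 1) + p * a := by
        rw [mul_add]; omega
      rw [e2, Nat.add_mul_div_left _ _ hp.pos, Nat.div_eq_of_lt (by omega)]
      omega
    rw [h1, h2, h3, Nat.choose_zero_right, one_mul] at h
    exact h.trans ih

theorem gcd_binomials_eq_one (n : ℕ) (hn : 1 ≤ n) :
    (Finset.Icc 1 (n / 2 + 1)).gcd
      (fun r => Nat.choose (n - (n / 2 + 1) + r) r) = 1 := by
  by_contra hne
  obtain ⟨p, hp, hdvd⟩ := Nat.exists_prime_and_dvd hne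
  rw [Finset.dvd_gcd_iff] at hdvd
  generalize hk : n - (n / 2 + 1) = k at hdvd
  obtain ⟨i, v, hv, hkv⟩ := Nat.exists_eq_pow_mul_and_not_dvd (Nat.succ_ne_zero k) p hp.ne_one
  have hv0 : 0 < v := Nat.pos_of_ne_zero (by rintro rfl; simp at hv)
  have hpi : 0 < p ^ i := pow_pos hp.pos i
  have hle : p ^ i ≤ k + 1 := Nat.le_of_dvd (Nat.succ_pos k) ⟨v, hkv⟩
  have h1 := hdvd (p ^ i) (Finset.mem_Icc.mpr ⟨hpi, by omega⟩)
  have e : k + p ^ i = p ^ i * (v + 1) - 1 := by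
    rw [mul_add, mul_one, ← hkv]; omega
  simp only [e] at h1
  exact hv (((aux_choose p hp v i).dvd_iff dvd_rfl).mp h1)
end
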